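/- arXiv:2507.20916 — 2 statements merged into one kernel-verified Lean document; each statement's English description precedes it below -/
import Mathlib

section
/- Let Ω ⊂ ℝⁿ be a bounded domain with smooth boundary and let u ∈ C⁰(closure(Ω)) ∩ C²(Ω) with 0 ≤ u < 1 in Ω be a stable solution of −Δu = f(u) in Ω with u = 0 on ∂Ω, where f ∈ C²([0,1)) satisfies f ≥ 0, f′ ≥ 0, f″ ≥ 0, and F(1) = +∞. Assume moreover that one of the following holds: (i) n ≤ 2; (ii) 3 ≤ n ≤ 6 and f^{−θ} is concave near 1 for some θ > 0 (equivalently liminf_{t→1⁻} f(t)f″(t)/f′(t)² > 1). Then there exists a constant C < 1, depending only on Ω and f, such that ‖u‖_{L∞(Ω)} ≤ C < 1. -/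
open MeasureTheory Set Filter Topology Bornology Metric

/-- The Laplacian of `u : ℝⁿ → ℝ`, as the sum of second partial derivatives. -/
noncomputable def lap {n : ℕ} (u : EuclideanSpace ℝ (Fin n) → ℝ)
    (x : EuclideanSpace ℝ (Fin n)) : ℝ :=
  ∑ i, fderiv ℝ (fun y => fderiv ℝ u y (EuclideanSpace.single i 1)) x (EuclideanSpace.single i 1)

/-- `f` is of class `C²([0,1))`, with first and second derivatives `f'`, `f''`. -/
def C2On01 (f f' f'' : ℝ → ℝ) : Prop :=
  (∀ t ∈ Ico (0:ℝ) 1, HasDerivWithinAt f (f' t) (Ico (0:ℝ) 1) t) ∧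
  (∀ t ∈ Ico (0:ℝ) 1, HasDerivWithinAt f' (f'' t) (Ico (0:ℝ) 1) t) ∧
  ContinuousOn f'' (Ico (0:ℝ) 1)

/-- Stability of a solution `u` of `-Δu = f(u)` in `Ω`: nonnegativity of the second variation of
the energy on all smooth test functions compactly supported in `Ω`. Here `f'` is the derivative
of the nonlinearity. -/
def StableSol {n : ℕ} (f' : ℝ → ℝ) (u : EuclideanSpace ℝ (Fin n) → ℝ)
    (Ω : Set (EuclideanSpace ℝ (Fin n))) : Prop :=
  ∀ ξ : EuclideanSpace ℝ (Fin n) → ℝ, ContDiff ℝ (⊤:ℕ∞) ξ → HasCompactSupport ξ →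
    tsupport ξ ⊆ Ω →
    0 ≤ ∫ x in Ω, (‖gradient ξ x‖ ^ 2 - f' (u x) * ξ x ^ 2)

/-- A bounded domain (open, connected) in `ℝⁿ` with smooth boundary, described by a smooth
defining function `ρ` whose gradient does not vanish on the boundary. -/
def SmoothBoundedDomain {n : ℕ} (Ω : Set (EuclideanSpace ℝ (Fin n))) : Prop :=
  IsOpen Ω ∧ IsBounded Ω ∧ IsConnected Ω ∧
  ∃ ρ : EuclideanSpace ℝ (Fin n) → ℝ, ContDiff ℝ (⊤:ℕ∞) ρ ∧ Ω = {x | ρ x < 0} ∧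
    ∀ x ∈ frontier Ω, fderiv ℝ ρ x ≠ 0

section Calculus

variable {E : Type*} [NormedAddCommGroup E] [NormedSpace ℝ E]

/-- A function which is `C^k` on an open set and vanishes there off a compact subset extends by
zero to a `C^k` function. -/
theorem contDiff_indicator_of_compact {k : ℕ∞} {Ω K : Set E} (hΩ : IsOpen Ω) (hK : IsCompact K)
    (hKΩ : K ⊆ Ω) {q : E → ℝ} (hq : ContDiffOn ℝ k q Ω) (hq0 : ∀ x ∈ Ω, x ∉ K → q x = 0) :
    ContDiff ℝ k (Ω.indicator q) := by
  rw [contDiff_iff_contDiffAt]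
  intro x
  by_cases hx : x ∈ Ω
  · refine (hq.contDiffAt (hΩ.mem_nhds hx)).congr_of_eventuallyEq ?_
    filter_upwards [hΩ.mem_nhds hx] with y hy using indicator_of_mem hy q
  · have hxK : x ∈ Kᶜ := fun h => hx (hKΩ h)
    refine (contDiffAt_const (c := (0 : ℝ))).congr_of_eventuallyEq ?_
    filter_upwards [hK.isClosed.isOpen_compl.mem_nhds hxK] with y hy
    by_cases hyΩ : y ∈ Ω
    · rw [indicator_of_mem hyΩ, hq0 y hyΩ hy]
    · rw [indicator_of_notMem hyΩ]

theorem tsupport_indicator_subset_of_compact {X : Type*} [TopologicalSpace X] [T2Space X]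
    {Ω K : Set X} (hK : IsCompact K) {q : X → ℝ} (hq0 : ∀ x ∈ Ω, x ∉ K → q x = 0) :
    tsupport (Ω.indicator q) ⊆ K := by
  refine closure_minimal (fun x hx => ?_) hK.isClosed
  by_contra hxK
  apply hx
  by_cases hxΩ : x ∈ Ω
  · rw [indicator_of_mem hxΩ, hq0 x hxΩ hxK]
  · rw [indicator_of_notMem hxΩ]

theorem fderiv_indicator_of_isOpen {Ω : Set E} (hΩ : IsOpen Ω) (q : E → ℝ) {x : E} (hx : x ∈ Ω) :
    fderiv ℝ (Ω.indicator q) x = fderiv ℝ q x := by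
  refine Filter.EventuallyEq.fderiv_eq ?_
  filter_upwards [hΩ.mem_nhds hx] with y hy using indicator_of_mem hy q

variable [FiniteDimensional ℝ E] [MeasurableSpace E] [BorelSpace E] {μ : Measure E}
  [μ.IsAddHaarMeasure]

theorem integral_fderiv_apply_eq_zero {V : E → ℝ} (hV : ContDiff ℝ 1 V)
    (hVc : HasCompactSupport V) (v : E) : ∫ x, fderiv ℝ V x v ∂μ = 0 := by
  have h := integral_mul_fderiv_eq_neg_fderiv_mul_of_integrable (μ := μ) (f := fun _ : E => (1:ℝ))
    (g := V) (v := v) (by simp) ?_ ?_ (by simp) (fun x _ => (hV.differentiable one_ne_zero) x)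
  · simpa using h
  · simpa using (((hV.continuous_fderiv one_ne_zero).clm_apply continuous_const)
      |>.integrable_of_hasCompactSupport (hVc.fderiv_apply (𝕜 := ℝ) v))
  · simpa using hV.continuous.integrable_of_hasCompactSupport hVc

/-- Integration by parts against a compactly supported function. -/
theorem integral_mul_fderiv_of_compact {g V : E → ℝ} (hg : ContDiff ℝ 1 g) (hV : ContDiff ℝ 1 V)
    (hVc : HasCompactSupport V) (v : E) :
    ∫ x, g x * fderiv ℝ V x v ∂μ = - ∫ x, fderiv ℝ g x v * V x ∂μ := by
  refine integral_mul_fderiv_eq_neg_fderiv_mul_of_integrable ?_ ?_ ?_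
    (fun x _ => (hg.differentiable one_ne_zero) x) (fun x _ => (hV.differentiable one_ne_zero) x)
  · exact (((hg.continuous_fderiv one_ne_zero).clm_apply continuous_const).mul hV.continuous)
      |>.integrable_of_hasCompactSupport hVc.mul_left
  · exact (hg.continuous.mul ((hV.continuous_fderiv one_ne_zero).clm_apply continuous_const))
      |>.integrable_of_hasCompactSupport (hVc.fderiv_apply (𝕜 := ℝ) v).mul_left
  · exact (hg.continuous.mul hV.continuous)
      |>.integrable_of_hasCompactSupport hVc.mul_left

theorem integral_mul_fderiv_fderiv_of_compact {g V : E → ℝ} (hg : ContDiff ℝ 2 g)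
    (hV : ContDiff ℝ 2 V) (hVc : HasCompactSupport V) (v : E) :
    ∫ x, g x * fderiv ℝ (fun y => fderiv ℝ V y v) x v ∂μ =
      ∫ x, fderiv ℝ (fun y => fderiv ℝ g y v) x v * V x ∂μ := by
  have hV' : ContDiff ℝ 1 (fun y => fderiv ℝ V y v) :=
    (hV.fderiv_right (m := 1) (by norm_num)).clm_apply contDiff_const
  have hg' : ContDiff ℝ 1 (fun y => fderiv ℝ g y v) :=
    (hg.fderiv_right (m := 1) (by norm_num)).clm_apply contDiff_const
  rw [integral_mul_fderiv_of_compact (hg.of_le (by norm_num)) hV' (hVc.fderiv_apply (𝕜 := ℝ) v),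
    integral_mul_fderiv_of_compact hg' (hV.of_le (by norm_num)) hVc, neg_neg]

end Calculus

section Mollification

variable {E : Type*} [NormedAddCommGroup E] [NormedSpace ℝ E] [FiniteDimensional ℝ E]

/-- Mollification of a compactly supported `C¹` function, with control of the support. -/
theorem exists_contDiff_approx_of_compact {ξ : E → ℝ} (hξ : ContDiff ℝ 1 ξ)
    (hξc : HasCompactSupport ξ) {δ ε : ℝ} (hδ : 0 < δ) (hε : 0 < ε) :
    ∃ ζ : E → ℝ, ContDiff ℝ (⊤ : ℕ∞) ζ ∧ tsupport ζ ⊆ cthickening δ (tsupport ξ) ∧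
      (∀ x, dist (ζ x) (ξ x) ≤ ε) ∧ ∀ x, dist (fderiv ℝ ζ x) (fderiv ℝ ξ x) ≤ ε := by
  borelize E
  let μ : Measure E := .addHaar
  have huc := hξc.uniformContinuous_of_continuous hξ.continuous
  have huc' := (hξc.fderiv (𝕜 := ℝ)).uniformContinuous_of_continuous
    (hξ.continuous_fderiv one_ne_zero)
  obtain ⟨δ₁, hδ₁, h₁⟩ := Metric.uniformContinuous_iff.mp huc ε hε
  obtain ⟨δ₂, hδ₂, h₂⟩ := Metric.uniformContinuous_iff.mp huc' ε hε
  set r := min δ (min δ₁ δ₂) with hr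
  have hr0 : 0 < r := by positivity
  let φ : ContDiffBump (0 : E) := ⟨r / 2, r, half_pos hr0, half_lt_self hr0⟩
  have hφr : φ.rOut = r := rfl
  let L := ContinuousLinearMap.lsmul ℝ ℝ (E := ℝ)
  let ζ : E → ℝ := convolution (φ.normed μ) ξ L μ
  have hd : ∀ x, fderiv ℝ ζ x =
      convolution (φ.normed μ) (fderiv ℝ ξ) (ContinuousLinearMap.lsmul ℝ ℝ) μ x := by
    intro x
    have := (hξc.hasFDerivAt_convolution_right L (f := φ.normed μ) (μ := μ)
      φ.continuous_normed.locallyIntegrable hξ x).fderiv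
    rw [this]
    rfl
  refine ⟨ζ, ?_, ?_, ?_, ?_⟩
  · exact φ.hasCompactSupport_normed.contDiff_convolution_left _ φ.contDiff_normed
      hξ.continuous.locallyIntegrable
  · refine closure_minimal (fun x hx => ?_) isClosed_cthickening
    by_contra hxK
    apply hx
    have hball : ∀ y ∈ ball x r, ξ y = 0 := by
      intro y hy
      by_contra hne
      apply hxK
      refine mem_cthickening_of_dist_le x y _ _ (subset_tsupport _ hne) ?_
      rw [dist_comm]
      exact (mem_ball.mp hy).le.trans (min_le_left _ _)
    have h0 : ξ x = 0 := hball x (mem_ball_self hr0)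
    change convolution (φ.normed μ) ξ L μ x = 0
    rw [φ.normed_convolution_eq_right (μ := μ) (g := ξ) (x₀ := x)
      (fun y hy => by rw [hball y hy, h0]), h0]
  · intro x
    refine φ.dist_normed_convolution_le hξ.continuous.aestronglyMeasurable (fun y hy => ?_)
    exact (h₁ ((mem_ball.mp hy).trans_le
      ((min_le_right _ _).trans (min_le_left _ _)))).le
  · intro x
    rw [hd x]
    refine φ.dist_normed_convolution_le
      (hξ.continuous_fderiv one_ne_zero).aestronglyMeasurable (fun y hy => ?_)
    exact (h₂ ((mem_ball.mp hy).trans_le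
      ((min_le_right _ _).trans (min_le_right _ _)))).le

end Mollification

theorem norm_gradient_eq {n : ℕ} (ξ : EuclideanSpace ℝ (Fin n) → ℝ)
    (x : EuclideanSpace ℝ (Fin n)) : ‖gradient ξ x‖ = ‖fderiv ℝ ξ x‖ := by
  simp [gradient]

/-- Stability may be tested with compactly supported functions that are only `C¹`. -/
theorem StableSol.nonneg_of_contDiff_one {n : ℕ} {f' : ℝ → ℝ}
    {u : EuclideanSpace ℝ (Fin n) → ℝ} {Ω : Set (EuclideanSpace ℝ (Fin n))} (hΩ : IsOpen Ω)
    (hst : StableSol f' u Ω) (hQ : ContinuousOn (fun x => f' (u x)) Ω)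
    {ξ : EuclideanSpace ℝ (Fin n) → ℝ} (hξ : ContDiff ℝ 1 ξ) (hξc : HasCompactSupport ξ)
    (hξΩ : tsupport ξ ⊆ Ω) :
    0 ≤ ∫ x in Ω, (‖fderiv ℝ ξ x‖ ^ 2 - f' (u x) * ξ x ^ 2) := by
  obtain ⟨δ, hδ, hδΩ⟩ := hξc.isCompact.exists_cthickening_subset_open hΩ hξΩ
  set K := cthickening δ (tsupport ξ) with hK
  have hKc : IsCompact K := hξc.isCompact.cthickening
  have hpos : ∀ k : ℕ, (0 : ℝ) < 1 / ((k : ℝ) + 1) := fun k => by positivity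
  choose ζ hζ hζK hζ1 hζ2 using fun k : ℕ =>
    exists_contDiff_approx_of_compact hξ hξc hδ (hpos k)
  obtain ⟨M, hM⟩ := hKc.exists_bound_of_continuousOn (hQ.mono hδΩ)
  obtain ⟨M₁, hM₁⟩ := hKc.exists_bound_of_continuousOn hξ.continuous.continuousOn
  obtain ⟨M₂, hM₂⟩ := hKc.exists_bound_of_continuousOn
    (hξ.continuous_fderiv one_ne_zero).continuousOn
  have hlim : Tendsto (fun k : ℕ => 1 / ((k : ℝ) + 1)) atTop (𝓝 0) :=
    tendsto_one_div_add_atTop_nhds_zero_nat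
  have hzero : ∀ k, ∀ x, x ∉ K → ζ k x = 0 ∧ fderiv ℝ (ζ k) x = 0 := by
    intro k x hx
    have hx' : x ∉ tsupport (ζ k) := fun h => hx (hζK k h)
    exact ⟨image_eq_zero_of_notMem_tsupport hx', by
      by_contra hne
      exact hx' (support_fderiv_subset ℝ hne)⟩
  refine ge_of_tendsto (x := atTop)
    (f := fun k => ∫ x in Ω, (‖fderiv ℝ (ζ k) x‖ ^ 2 - f' (u x) * ζ k x ^ 2)) ?_ ?_
  · refine tendsto_integral_of_dominated_convergence
      (K.indicator fun _ => (|M₂| + 1) ^ 2 + |M| * (|M₁| + 1) ^ 2) ?_ ?_ ?_ ?_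
    · intro k
      refine (ContinuousOn.sub ?_ (hQ.mul ?_)).aestronglyMeasurable hΩ.measurableSet
      · exact (((hζ k).continuous_fderiv (by simp)).norm.pow 2).continuousOn
      · exact ((hζ k).continuous.pow 2).continuousOn
    · refine (Integrable.integrableOn ?_)
      rw [integrable_indicator_iff hKc.measurableSet]
      exact integrableOn_const hKc.measure_lt_top.ne
    · intro k
      refine Eventually.of_forall fun x => ?_
      by_cases hx : x ∈ K
      · rw [indicator_of_mem hx]
        have hk1 : 1 / ((k : ℝ) + 1) ≤ 1 := by
          rw [div_le_one (by positivity)]; linarith [(Nat.cast_nonneg k : (0:ℝ) ≤ k)]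
        have e1 : |ζ k x| ≤ |M₁| + 1 := by
          have a := hζ1 k x
          have b := hM₁ x hx
          rw [Real.dist_eq] at a
          rw [Real.norm_eq_abs] at b
          have c := abs_sub_abs_le_abs_sub (ζ k x) (ξ x)
          linarith [le_abs_self M₁]
        have e2 : ‖fderiv ℝ (ζ k) x‖ ≤ |M₂| + 1 := by
          have a := hζ2 k x
          have b := hM₂ x hx
          rw [dist_eq_norm] at a
          have c := norm_sub_norm_le (fderiv ℝ (ζ k) x) (fderiv ℝ ξ x)
          linarith [le_abs_self M₂]
        have e3 : |f' (u x)| ≤ |M| := (hM x hx).trans (le_abs_self M)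
        rw [Real.norm_eq_abs]
        refine (abs_sub _ _).trans ?_
        rw [abs_mul, abs_pow, abs_pow, abs_norm]
        gcongr
      · rw [indicator_of_notMem hx, (hzero k x hx).1, (hzero k x hx).2]
        simp
    · refine Eventually.of_forall fun x => ?_
      have t1 : Tendsto (fun k => ζ k x) atTop (𝓝 (ξ x)) :=
        tendsto_iff_dist_tendsto_zero.mpr
          (squeeze_zero (fun _ => dist_nonneg) (fun k => hζ1 k x) hlim)
      have t2 : Tendsto (fun k => fderiv ℝ (ζ k) x) atTop (𝓝 (fderiv ℝ ξ x)) :=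
        tendsto_iff_dist_tendsto_zero.mpr
          (squeeze_zero (fun _ => dist_nonneg) (fun k => hζ2 k x) hlim)
      exact (t2.norm.pow 2).sub ((t1.pow 2).const_mul _)
  · refine Eventually.of_forall fun k => ?_
    have := hst (ζ k) (hζ k) (hKc.of_isClosed_subset (isClosed_tsupport _) (hζK k))
      ((hζK k).trans hδΩ)
    simpa only [norm_gradient_eq] using this

section Composition

variable {n : ℕ} {Ω : Set (EuclideanSpace ℝ (Fin n))} {u : EuclideanSpace ℝ (Fin n) → ℝ}

/-- Superlevel sets at positive height, of a function vanishing on the boundary, are compact subsets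
of the domain. -/
theorem isCompact_superlevel (hΩ : IsOpen Ω) (hb : IsBounded Ω)
    (hu : ContinuousOn u (closure Ω)) (hbd : ∀ x ∈ frontier Ω, u x = 0) {c : ℝ} (hc : 0 < c) :
    IsCompact {x ∈ closure Ω | c ≤ u x} ∧ {x ∈ closure Ω | c ≤ u x} ⊆ Ω := by
  constructor
  · have h1 : IsCompact (closure Ω) := hb.isCompact_closure
    exact h1.of_isClosed_subset (hu.preimage_isClosed_of_isClosed isClosed_closure isClosed_Ici)
      (fun x hx => hx.1)
  · rintro x ⟨hx, hcx⟩
    by_contra hxΩ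
    have : x ∈ frontier Ω := by
      rw [hΩ.frontier_eq]; exact ⟨hx, hxΩ⟩
    rw [hbd x this] at hcx
    linarith

theorem eq_zero_of_notMem_superlevel {c : ℝ} {G : ℝ → ℝ}
    (hG0 : ∀ t < c, G t = 0) : ∀ x ∈ Ω, x ∉ {x ∈ closure Ω | c ≤ u x} → G (u x) = 0 := by
  intro x hx hxK
  refine hG0 _ (lt_of_not_ge fun h => hxK ⟨subset_closure hx, h⟩)

theorem deriv_eq_zero_of_forall_lt {c : ℝ} {G : ℝ → ℝ} (hG0 : ∀ t < c, G t = 0) :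
    ∀ t < c, deriv G t = 0 := by
  intro t ht
  have : G =ᶠ[𝓝 t] fun _ => 0 := by
    filter_upwards [Iio_mem_nhds ht] with s hs using hG0 s hs
  rw [this.deriv_eq, deriv_const]

theorem EuclideanSpace.norm_sq_clm_eq_sum (L : EuclideanSpace ℝ (Fin n) →L[ℝ] ℝ) :
    ‖L‖ ^ 2 = ∑ i, L (EuclideanSpace.single i 1) ^ 2 := by
  have h1 : ‖L‖ = ‖(InnerProductSpace.toDual ℝ _).symm L‖ := by simp
  rw [h1, EuclideanSpace.norm_sq_eq]
  refine Finset.sum_congr rfl fun i _ => ?_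
  have h2 : L (EuclideanSpace.single i 1) =
      inner ℝ ((InnerProductSpace.toDual ℝ _).symm L) (EuclideanSpace.single i (1:ℝ)) := by
    rw [InnerProductSpace.toDual_symm_apply]
  rw [h2, EuclideanSpace.inner_single_right]
  simp

theorem hasFDerivAt_comp_of_contDiffOn (hΩ : IsOpen Ω) (hu2 : ContDiffOn ℝ 2 u Ω)
    (hu1 : ∀ x ∈ Ω, u x < 1) {G : ℝ → ℝ} (hG : ContDiffOn ℝ 1 G (Iio 1))
    {x : EuclideanSpace ℝ (Fin n)} (hx : x ∈ Ω) :
    HasFDerivAt (fun y => G (u y)) (deriv G (u x) • fderiv ℝ u x) x := by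
  have h1 : HasDerivAt G (deriv G (u x)) (u x) :=
    ((hG.differentiableOn one_ne_zero).differentiableAt (Iio_mem_nhds (hu1 x hx))).hasDerivAt
  have h2 : HasFDerivAt u (fderiv ℝ u x) x :=
    ((hu2.differentiableOn two_ne_zero).differentiableAt (hΩ.mem_nhds hx)).hasFDerivAt
  exact h1.comp_hasFDerivAt x h2

theorem contDiffOn_fderiv_apply (hΩ : IsOpen Ω) (hu2 : ContDiffOn ℝ 2 u Ω)
    (v : EuclideanSpace ℝ (Fin n)) : ContDiffOn ℝ 1 (fun y => fderiv ℝ u y v) Ω :=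
  (hu2.fderiv_of_isOpen hΩ (m := 1) (by norm_num)).clm_apply contDiffOn_const

theorem fderiv_comp_mul_fderiv (hΩ : IsOpen Ω) (hu2 : ContDiffOn ℝ 2 u Ω)
    (hu1 : ∀ x ∈ Ω, u x < 1) {G : ℝ → ℝ} (hG : ContDiffOn ℝ 1 G (Iio 1))
    (v : EuclideanSpace ℝ (Fin n)) {x : EuclideanSpace ℝ (Fin n)} (hx : x ∈ Ω) :
    fderiv ℝ (fun y => G (u y) * fderiv ℝ u y v) x v =
      deriv G (u x) * fderiv ℝ u x v ^ 2 +
        G (u x) * fderiv ℝ (fun y => fderiv ℝ u y v) x v := by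
  have h1 := hasFDerivAt_comp_of_contDiffOn hΩ hu2 hu1 hG hx
  have h2 : DifferentiableAt ℝ (fun y => fderiv ℝ u y v) x :=
    ((contDiffOn_fderiv_apply hΩ hu2 v).differentiableOn one_ne_zero).differentiableAt
      (hΩ.mem_nhds hx)
  rw [(h1.fun_mul h2.hasFDerivAt).fderiv]
  simp
  ring

/-- The divergence theorem for the field `g(u) ∇u`. -/
theorem integral_divergence_comp (hΩ : IsOpen Ω) (hb : IsBounded Ω)
    (hu : ContinuousOn u (closure Ω)) (hbd : ∀ x ∈ frontier Ω, u x = 0)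
    (hu2 : ContDiffOn ℝ 2 u Ω) (hu1 : ∀ x ∈ Ω, u x < 1) {c : ℝ} (hc : 0 < c) {g : ℝ → ℝ}
    (hg : ContDiffOn ℝ 1 g (Iio 1)) (hg0 : ∀ t < c, g t = 0) :
    ∫ x in Ω, (deriv g (u x) * ‖fderiv ℝ u x‖ ^ 2 + g (u x) * lap u x) = 0 := by
  obtain ⟨hK, hKΩ⟩ := isCompact_superlevel hΩ hb hu hbd hc
  set K := {x ∈ closure Ω | c ≤ u x}
  let e : Fin n → EuclideanSpace ℝ (Fin n) := fun i => EuclideanSpace.single i 1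
  let q : Fin n → EuclideanSpace ℝ (Fin n) → ℝ := fun i y => g (u y) * fderiv ℝ u y (e i)
  have hq0 : ∀ i, ∀ x ∈ Ω, x ∉ K → q i x = 0 := fun i x hx hxK => by
    simp only [q, eq_zero_of_notMem_superlevel hg0 x hx hxK, zero_mul]
  have hq : ∀ i, ContDiffOn ℝ 1 (q i) Ω := fun i =>
    (hg.comp (hu2.of_le (by norm_num)) hu1).mul (contDiffOn_fderiv_apply hΩ hu2 _)
  have hV : ∀ i, ContDiff ℝ 1 (Ω.indicator (q i)) := fun i =>
    contDiff_indicator_of_compact (k := 1) hΩ hK hKΩ (hq i) (hq0 i)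
  have hVs : ∀ i, tsupport (Ω.indicator (q i)) ⊆ K := fun i =>
    tsupport_indicator_subset_of_compact hK (hq0 i)
  have hVc : ∀ i, HasCompactSupport (Ω.indicator (q i)) := fun i =>
    hK.of_isClosed_subset (isClosed_tsupport _) (hVs i)
  have h_int : ∀ i, Integrable (fun x => fderiv ℝ (Ω.indicator (q i)) x (e i)) := fun i =>
    (((hV i).continuous_fderiv one_ne_zero).clm_apply continuous_const)
      |>.integrable_of_hasCompactSupport ((hVc i).fderiv_apply (𝕜 := ℝ) _)
  have hsum : ∫ x, ∑ i, fderiv ℝ (Ω.indicator (q i)) x (e i) = 0 := by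
    rw [integral_finsetSum _ fun i _ => h_int i]
    exact Finset.sum_eq_zero fun i _ => integral_fderiv_apply_eq_zero (hV i) (hVc i) _
  rw [← setIntegral_eq_integral_of_forall_compl_eq_zero (s := Ω)] at hsum
  · rw [← hsum]
    refine setIntegral_congr_fun hΩ.measurableSet fun x hx => ?_
    simp only [fderiv_indicator_of_isOpen hΩ _ hx]
    simp only [q, fderiv_comp_mul_fderiv hΩ hu2 hu1 hg _ hx, Finset.sum_add_distrib,
      ← Finset.mul_sum, EuclideanSpace.norm_sq_clm_eq_sum, e]
    rfl
  · intro x hx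
    refine Finset.sum_eq_zero fun i _ => ?_
    have : fderiv ℝ (Ω.indicator (q i)) x = 0 := by
      by_contra hne
      exact hx (hKΩ (hVs i (support_fderiv_subset ℝ hne)))
    simp [this]

/-- A function continuous on an open set and vanishing off a compact subset is integrable. -/
theorem integrableOn_of_compact (hΩ : IsOpen Ω) {K : Set (EuclideanSpace ℝ (Fin n))}
    (hK : IsCompact K) (hKΩ : K ⊆ Ω) {q : EuclideanSpace ℝ (Fin n) → ℝ} (hq : ContinuousOn q Ω)
    (hq0 : ∀ x ∈ Ω, x ∉ K → q x = 0) : IntegrableOn q Ω := by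
  have h1 : IntegrableOn q K := (hq.mono hKΩ).integrableOn_compact hK
  exact h1.of_forall_sdiff_eq_zero hΩ.measurableSet fun x hx => hq0 x hx.1 hx.2

/-- Stability tested with `φ(u)`, combined with the equation. -/
theorem StableSol.integral_comp_nonneg (hΩ : IsOpen Ω) (hb : IsBounded Ω) {f f' : ℝ → ℝ}
    (hf : ContinuousOn f (Ico 0 1)) (hf' : ContinuousOn f' (Ico 0 1))
    (hu : ContinuousOn u (closure Ω)) (hbd : ∀ x ∈ frontier Ω, u x = 0)
    (hu2 : ContDiffOn ℝ 2 u Ω) (hu1 : ∀ x ∈ Ω, 0 ≤ u x ∧ u x < 1)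
    (heq : ∀ x ∈ Ω, -lap u x = f (u x)) (hst : StableSol f' u Ω) {c : ℝ} (hc : 0 < c)
    {φ g : ℝ → ℝ} (hφ : ContDiffOn ℝ 1 φ (Iio 1)) (hφ0 : ∀ t < c, φ t = 0)
    (hg : ∀ t < 1, HasDerivAt g (deriv φ t ^ 2) t) (hg0 : ∀ t < c, g t = 0) :
    IntegrableOn (fun x => f (u x) * g (u x) - f' (u x) * φ (u x) ^ 2) Ω ∧
    0 ≤ ∫ x in Ω, (f (u x) * g (u x) - f' (u x) * φ (u x) ^ 2) := by
  obtain ⟨hK, hKΩ⟩ := isCompact_superlevel hΩ hb hu hbd hc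
  set K := {x ∈ closure Ω | c ≤ u x} with hKdef
  have hu1' : ∀ x ∈ Ω, u x < 1 := fun x hx => (hu1 x hx).2
  have huc : ContinuousOn u Ω := hu2.continuousOn
  have hmaps : MapsTo u Ω (Ico 0 1) := hu1
  have hmaps' : MapsTo u Ω (Iio 1) := hu1'
  have hdφ : ContinuousOn (deriv φ) (Iio 1) := hφ.continuousOn_deriv_of_isOpen isOpen_Iio le_rfl
  have hg1 : ContDiffOn ℝ 1 g (Iio 1) := by
    have : (1 : WithTop ℕ∞) = 0 + 1 := by norm_num
    rw [this, contDiffOn_succ_iff_deriv_of_isOpen isOpen_Iio]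
    refine ⟨fun t ht => (hg t ht).differentiableAt.differentiableWithinAt, by simp, ?_⟩
    rw [contDiffOn_zero]
    exact (hdφ.pow 2).congr fun t ht => (hg t ht).deriv
  have hcf := hf.comp huc hmaps
  have hcf' := hf'.comp huc hmaps
  have hcg := hg1.continuousOn.comp huc hmaps'
  have hcφ := hφ.continuousOn.comp huc hmaps'
  have hcd := hdφ.comp huc hmaps'
  have hcu : ContinuousOn (fun x => ‖fderiv ℝ u x‖ ^ 2) Ω :=
    ((hu2.continuousOn_fderiv_of_isOpen hΩ (by norm_num)).norm).pow 2
  have zφ := eq_zero_of_notMem_superlevel (Ω := Ω) (u := u) hφ0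
  have zg := eq_zero_of_notMem_superlevel (Ω := Ω) (u := u) hg0
  have zd := eq_zero_of_notMem_superlevel (Ω := Ω) (u := u) (deriv_eq_zero_of_forall_lt hφ0)
  have i1 : IntegrableOn (fun x => f (u x) * g (u x)) Ω :=
    integrableOn_of_compact hΩ hK hKΩ (hcf.mul hcg) fun x hx hxK => by rw [zg x hx hxK, mul_zero]
  have i2 : IntegrableOn (fun x => f' (u x) * φ (u x) ^ 2) Ω :=
    integrableOn_of_compact hΩ hK hKΩ (hcf'.mul (hcφ.pow 2)) fun x hx hxK => by
      rw [zφ x hx hxK]; ring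
  have i3 : IntegrableOn (fun x => deriv φ (u x) ^ 2 * ‖fderiv ℝ u x‖ ^ 2) Ω :=
    integrableOn_of_compact hΩ hK hKΩ ((hcd.pow 2).mul hcu) fun x hx hxK => by
      rw [zd x hx hxK]; ring
  refine ⟨i1.sub i2, ?_⟩
  have hdiv := integral_divergence_comp hΩ hb hu hbd hu2 hu1' hc hg1 hg0
  have hdiv' : ∫ x in Ω, deriv φ (u x) ^ 2 * ‖fderiv ℝ u x‖ ^ 2 =
      ∫ x in Ω, f (u x) * g (u x) := by
    rw [← sub_eq_zero, ← integral_sub i3 i1, ← hdiv]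
    refine setIntegral_congr_fun hΩ.measurableSet fun x hx => ?_
    simp only [(hg _ (hu1' x hx)).deriv, ← heq x hx]
    ring
  have zφ' : ∀ x ∈ Ω, x ∉ K → φ (u x) = 0 := zφ
  have hξ : ContDiff ℝ 1 (Ω.indicator fun x => φ (u x)) :=
    contDiff_indicator_of_compact (k := 1) hΩ hK hKΩ
      (hφ.comp (hu2.of_le (by norm_num)) hu1') zφ'
  have hξs := tsupport_indicator_subset_of_compact hK zφ'
  have hS := hst.nonneg_of_contDiff_one hΩ hcf' hξ
    (hK.of_isClosed_subset (isClosed_tsupport _) hξs) (hξs.trans hKΩ)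
  rw [integral_sub i1 i2, ← hdiv', ← integral_sub i3 i2]
  refine hS.trans_eq (setIntegral_congr_fun hΩ.measurableSet fun x hx => ?_)
  simp only [fderiv_indicator_of_isOpen hΩ _ hx, indicator_of_mem hx,
    (hasFDerivAt_comp_of_contDiffOn hΩ hu2 hu1' hφ hx).fderiv, norm_smul, mul_pow,
    Real.norm_eq_abs, sq_abs]

end Composition

section Kernel

/-- The radial profile `s ↦ ∫ₛˢ' σ^{-α} dσ`; for `α = n / 2` and `s = ‖y‖² + ε` it is a regularized
fundamental solution of the Laplacian on `ℝⁿ`. -/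
noncomputable def radialProfile (α S s : ℝ) : ℝ := ∫ σ in s..S, σ ^ (-α)

theorem hasDerivAt_radialProfile {α S s : ℝ} (hS : 0 < S) (hs : 0 < s) :
    HasDerivAt (radialProfile α S) (-s ^ (-α)) s := by
  have hcont : ContinuousOn (fun σ : ℝ => σ ^ (-α)) (uIcc s S) := by
    intro σ hσ
    have : 0 < σ := lt_of_lt_of_le (lt_min hs hS) hσ.1
    exact (Real.continuousAt_rpow_const _ _ (Or.inl this.ne')).continuousWithinAt
  refine intervalIntegral.integral_hasDerivAt_left hcont.intervalIntegrable ?_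
    (Real.continuousAt_rpow_const _ _ (Or.inl hs.ne'))
  refine ContinuousOn.stronglyMeasurableAtFilter (s := Ioi 0) isOpen_Ioi ?_ s hs
  intro σ hσ
  exact (Real.continuousAt_rpow_const _ _ (Or.inl (ne_of_gt hσ))).continuousWithinAt

theorem contDiffOn_radialProfile {α S : ℝ} (hS : 0 < S) :
    ContDiffOn ℝ 2 (radialProfile α S) (Ioi 0) := by
  have : (2 : WithTop ℕ∞) = 1 + 1 := by norm_num
  rw [this, contDiffOn_succ_iff_deriv_of_isOpen isOpen_Ioi]
  refine ⟨fun t ht => (hasDerivAt_radialProfile hS ht).differentiableAt.differentiableWithinAt,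
    by simp, ?_⟩
  have h : ContDiffOn ℝ 1 (fun s : ℝ => -s ^ (-α)) (Ioi 0) := by
    intro s hs
    exact ((Real.contDiffAt_rpow_const_of_ne (ne_of_gt hs)).neg).contDiffWithinAt
  exact h.congr fun t ht => (hasDerivAt_radialProfile hS ht).deriv

theorem radialProfile_nonneg {α S s : ℝ} (hs : 0 < s) (hsS : s ≤ S) : 0 ≤ radialProfile α S s :=
  intervalIntegral.integral_nonneg hsS fun _ hσ => Real.rpow_nonneg (hs.le.trans hσ.1) _

theorem radialProfile_le {α S s a : ℝ} (hs : 0 < s) (hsS : s ≤ S) (ha : 0 ≤ a) (haα : α - 1 < a) :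
    radialProfile α S s ≤ S ^ (a - α + 1) / (a - α + 1) * s ^ (-a) := by
  have hpos : ∀ σ ∈ Icc s S, 0 < σ := fun σ hσ => hs.trans_le hσ.1
  have hII : ∀ β : ℝ, IntervalIntegrable (fun σ : ℝ => σ ^ β) volume s S := fun β => by
    refine ContinuousOn.intervalIntegrable fun σ hσ => ?_
    rw [uIcc_of_le hsS] at hσ
    exact (Real.continuousAt_rpow_const _ _ (Or.inl (hpos σ hσ).ne')).continuousWithinAt
  calc radialProfile α S s ≤ ∫ σ in s..S, σ ^ (a - α) * s ^ (-a) := by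
        refine intervalIntegral.integral_mono_on hsS (hII _) ((hII _).mul_const _) fun σ hσ => ?_
        have hσ0 := hpos σ hσ
        have : σ ^ (-α) = σ ^ (a - α) * σ ^ (-a) := by
          rw [← Real.rpow_add hσ0]; congr 1; ring
        rw [this]
        refine mul_le_mul_of_nonneg_left ?_ (Real.rpow_nonneg hσ0.le _)
        exact Real.rpow_le_rpow_of_nonpos hs hσ.1 (by linarith)
    _ = (S ^ (a - α + 1) - s ^ (a - α + 1)) / (a - α + 1) * s ^ (-a) := by
        rw [intervalIntegral.integral_mul_const, integral_rpow (Or.inl (by linarith))]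
    _ ≤ _ := by
        refine mul_le_mul_of_nonneg_right ?_ (Real.rpow_nonneg hs.le _)
        refine div_le_div_of_nonneg_right ?_ (by linarith)
        linarith [Real.rpow_nonneg hs.le (a - α + 1)]

variable {n : ℕ}

/-- The regularized fundamental solution with pole `x₀`. -/
noncomputable def regKernel (S ε : ℝ) (x₀ y : EuclideanSpace ℝ (Fin n)) : ℝ :=
  radialProfile ((n : ℝ) / 2) S (‖y - x₀‖ ^ 2 + ε)

theorem contDiff_regKernel {S ε : ℝ} (hS : 0 < S) (hε : 0 < ε) (x₀ : EuclideanSpace ℝ (Fin n)) :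
    ContDiff ℝ 2 (regKernel S ε x₀) := by
  rw [← contDiffOn_univ]
  refine (contDiffOn_radialProfile hS).comp (t := Ioi 0) ?_ fun y _ => ?_
  · exact (((contDiff_id.sub contDiff_const).norm_sq ℝ).add contDiff_const).contDiffOn
  · exact add_pos_of_nonneg_of_pos (sq_nonneg _) hε

theorem hasFDerivAt_norm_sub_sq_add (ε : ℝ) (x₀ y : EuclideanSpace ℝ (Fin n)) :
    HasFDerivAt (fun z => ‖z - x₀‖ ^ 2 + ε) (2 • innerSL ℝ (y - x₀)) y := by
  have h := ((hasFDerivAt_id y).sub_const x₀).norm_sq.add_const ε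
  simpa using h

theorem fderiv_regKernel {S ε : ℝ} (hS : 0 < S) (hε : 0 < ε)
    (x₀ y v : EuclideanSpace ℝ (Fin n)) :
    fderiv ℝ (regKernel S ε x₀) y v =
      -(‖y - x₀‖ ^ 2 + ε) ^ (-((n : ℝ) / 2)) * (2 * inner ℝ (y - x₀) v) := by
  have hs : 0 < ‖y - x₀‖ ^ 2 + ε := add_pos_of_nonneg_of_pos (sq_nonneg _) hε
  have h := (hasDerivAt_radialProfile (α := (n : ℝ) / 2) hS hs).comp_hasFDerivAt y
    (hasFDerivAt_norm_sub_sq_add ε x₀ y)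
  have h' : HasFDerivAt (regKernel S ε x₀) _ y := h
  rw [h'.fderiv]
  simp [inner_sub_left]

theorem fderiv_fderiv_regKernel {S ε : ℝ} (hS : 0 < S) (hε : 0 < ε)
    (x₀ y v : EuclideanSpace ℝ (Fin n)) :
    fderiv ℝ (fun z => fderiv ℝ (regKernel S ε x₀) z v) y v =
      2 * n * (‖y - x₀‖ ^ 2 + ε) ^ (-((n : ℝ) / 2) - 1) * inner ℝ (y - x₀) v ^ 2 -
        2 * (‖y - x₀‖ ^ 2 + ε) ^ (-((n : ℝ) / 2)) * ‖v‖ ^ 2 := by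
  have hs : 0 < ‖y - x₀‖ ^ 2 + ε := add_pos_of_nonneg_of_pos (sq_nonneg _) hε
  have e : (fun z => fderiv ℝ (regKernel S ε x₀) z v) = fun z =>
      (-(‖z - x₀‖ ^ 2 + ε) ^ (-((n : ℝ) / 2))) * (2 * inner ℝ (z - x₀) v) :=
    funext fun z => fderiv_regKernel hS hε x₀ z v
  rw [e]
  have h1 := ((Real.hasDerivAt_rpow_const (p := -((n : ℝ) / 2)) (Or.inl hs.ne')).comp_hasFDerivAt y
    (hasFDerivAt_norm_sub_sq_add ε x₀ y)).neg
  have h2 : HasFDerivAt (fun z => 2 * inner ℝ (z - x₀) v) ((2 : ℝ) • innerSL ℝ v) y := by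
    have h3 := ((innerSL ℝ v).hasFDerivAt.comp y ((hasFDerivAt_id y).sub_const x₀)).const_mul 2
    refine (h3.congr_of_eventuallyEq (Eventually.of_forall fun z => ?_))
    simp [real_inner_comm]
  have h4 := h1.fun_mul h2
  have h5 : HasFDerivAt (fun z => (-(‖z - x₀‖ ^ 2 + ε) ^ (-((n : ℝ) / 2))) *
      (2 * inner ℝ (z - x₀) v)) _ y := h4
  rw [h5.fderiv]
  simp only [inner_sub_left]
  simp
  ring

theorem lap_regKernel {S ε : ℝ} (hS : 0 < S) (hε : 0 < ε) (x₀ y : EuclideanSpace ℝ (Fin n)) :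
    lap (regKernel S ε x₀) y =
      -(2 * n * ε * (‖y - x₀‖ ^ 2 + ε) ^ (-((n : ℝ) / 2) - 1)) := by
  have hs : 0 < ‖y - x₀‖ ^ 2 + ε := add_pos_of_nonneg_of_pos (sq_nonneg _) hε
  unfold lap
  simp only [fderiv_fderiv_regKernel hS hε, Finset.sum_sub_distrib]
  rw [← Finset.mul_sum]
  have h1 : ∑ i : Fin n, inner ℝ (y - x₀) (EuclideanSpace.single i (1:ℝ)) ^ 2 = ‖y - x₀‖ ^ 2 := by
    rw [EuclideanSpace.norm_sq_eq]
    refine Finset.sum_congr rfl fun i _ => ?_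
    rw [EuclideanSpace.inner_single_right]
    simp
  have h2 : (‖y - x₀‖ ^ 2 + ε) ^ (-((n : ℝ) / 2)) =
      (‖y - x₀‖ ^ 2 + ε) ^ (-((n : ℝ) / 2) - 1) * (‖y - x₀‖ ^ 2 + ε) := by
    rw [Real.rpow_sub_one hs.ne']
    field_simp
  rw [h1, h2]
  simp
  ring

theorem integral_regKernel_mul_lap {S ε : ℝ} (hS : 0 < S) (hε : 0 < ε)
    (x₀ : EuclideanSpace ℝ (Fin n)) {W : EuclideanSpace ℝ (Fin n) → ℝ} (hW : ContDiff ℝ 2 W)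
    (hWc : HasCompactSupport W) :
    ∫ y, regKernel S ε x₀ y * -lap W y =
      ∫ y, 2 * n * ε * (‖y - x₀‖ ^ 2 + ε) ^ (-((n : ℝ) / 2) - 1) * W y := by
  have hΓ := contDiff_regKernel hS hε x₀
  let e : Fin n → EuclideanSpace ℝ (Fin n) := fun i => EuclideanSpace.single i 1
  have hc : ∀ {V : EuclideanSpace ℝ (Fin n) → ℝ}, ContDiff ℝ 2 V → ∀ i,
      Continuous fun y => fderiv ℝ (fun z => fderiv ℝ V z (e i)) y (e i) := fun hV i =>
    (((hV.fderiv_right (m := 1) (by norm_num)).clm_apply contDiff_const).continuous_fderiv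
      one_ne_zero).clm_apply continuous_const
  have i1 : ∀ i, Integrable
      (fun y => regKernel S ε x₀ y * fderiv ℝ (fun z => fderiv ℝ W z (e i)) y (e i)) := fun i =>
    (hΓ.continuous.mul (hc hW i)).integrable_of_hasCompactSupport
      (((hWc.fderiv_apply (𝕜 := ℝ) (e i)).fderiv_apply (𝕜 := ℝ) (e i)).mul_left)
  have i2 : ∀ i, Integrable
      (fun y => fderiv ℝ (fun z => fderiv ℝ (regKernel S ε x₀) z (e i)) y (e i) * W y) := fun i =>
    ((hc hΓ i).mul hW.continuous).integrable_of_hasCompactSupport hWc.mul_left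
  have key : ∫ y, regKernel S ε x₀ y * lap W y = ∫ y, lap (regKernel S ε x₀) y * W y := by
    simp only [lap, Finset.mul_sum, Finset.sum_mul]
    rw [integral_finsetSum _ fun i _ => i1 i, integral_finsetSum _ fun i _ => i2 i]
    exact Finset.sum_congr rfl fun i _ => integral_mul_fderiv_fderiv_of_compact hΓ hW hWc (e i)
  simp only [mul_neg, integral_neg, key, lap_regKernel hS hε]
  rw [← integral_neg]
  refine integral_congr_ae (Eventually.of_forall fun y => ?_)
  simp

end Kernel

section PointwiseBound

variable {n : ℕ}

theorem exists_le_integral_approx_identity (hn : 1 ≤ n) {W : EuclideanSpace ℝ (Fin n) → ℝ}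
    (hW : Continuous W) (hWc : HasCompactSupport W) (hW0 : ∀ x, 0 ≤ W x)
    (x₀ : EuclideanSpace ℝ (Fin n)) :
    ∃ ε : ℝ, 0 < ε ∧ ε ≤ 1 ∧
      n * 2 ^ (-((n : ℝ) / 2) - 1) * volume.real (ball (0 : EuclideanSpace ℝ (Fin n)) 1) * W x₀ ≤
        ∫ y, 2 * n * ε * (‖y - x₀‖ ^ 2 + ε) ^ (-((n : ℝ) / 2) - 1) * W y := by
  have : NeZero n := ⟨by omega⟩
  have hpos : ∀ {ε : ℝ}, 0 < ε → ∀ y : EuclideanSpace ℝ (Fin n), 0 < ‖y - x₀‖ ^ 2 + ε :=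
    fun hε y => add_pos_of_nonneg_of_pos (sq_nonneg _) hε
  have hnn : ∀ {ε : ℝ}, 0 < ε → ∀ y,
      0 ≤ 2 * n * ε * (‖y - x₀‖ ^ 2 + ε) ^ (-((n : ℝ) / 2) - 1) * W y := fun hε y =>
    mul_nonneg (mul_nonneg (by positivity) (Real.rpow_nonneg (hpos hε y).le _)) (hW0 y)
  rcases (hW0 x₀).eq_or_lt with h0 | h0
  · exact ⟨1, one_pos, le_rfl, by rw [← h0, mul_zero]; exact integral_nonneg (hnn one_pos)⟩
  obtain ⟨ρ', hρ', hball⟩ := Metric.eventually_nhds_iff.1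
    (hW.continuousAt.eventually (lt_mem_nhds (half_lt_self h0)))
  let ρ := min ρ' 1
  have hρ : 0 < ρ := lt_min hρ' one_pos
  have hρ1 : ρ ≤ 1 := min_le_right _ _
  have hε : 0 < ρ ^ 2 := by positivity
  refine ⟨ρ ^ 2, hε, by nlinarith, ?_⟩
  have hcont : Continuous fun y =>
      2 * n * ρ ^ 2 * (‖y - x₀‖ ^ 2 + ρ ^ 2) ^ (-((n : ℝ) / 2) - 1) * W y := by
    refine (continuous_const.mul (Continuous.rpow_const ?_ fun y => Or.inl (hpos hε y).ne')).mul hW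
    fun_prop
  have h_int := hcont.integrable_of_hasCompactSupport (μ := volume) hWc.mul_left
  have hvol : volume.real (ball x₀ ρ) =
      ρ ^ n * volume.real (ball (0 : EuclideanSpace ℝ (Fin n)) 1) := by
    rw [measureReal_def, Measure.addHaar_ball _ _ hρ.le, ENNReal.toReal_mul,
      ENNReal.toReal_ofReal (by positivity), finrank_euclideanSpace_fin, measureReal_def]
  have hscale : ρ ^ n * (ρ ^ 2 * (2 * ρ ^ 2) ^ (-((n : ℝ) / 2) - 1)) =
      2 ^ (-((n : ℝ) / 2) - 1) := by
    rw [Real.mul_rpow (by norm_num) hε.le, ← Real.rpow_natCast ρ 2, ← Real.rpow_mul hρ.le,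
      ← Real.rpow_natCast ρ n]
    have : ρ ^ (n : ℝ) * ρ ^ ((2 : ℕ) : ℝ) * ρ ^ (((2 : ℕ) : ℝ) * (-((n : ℝ) / 2) - 1)) = 1 := by
      rw [← Real.rpow_add hρ, ← Real.rpow_add hρ]
      convert Real.rpow_zero ρ using 2
      push_cast
      ring
    linear_combination (2 : ℝ) ^ (-((n : ℝ) / 2) - 1) * this
  calc n * 2 ^ (-((n : ℝ) / 2) - 1) * volume.real (ball (0 : EuclideanSpace ℝ (Fin n)) 1) * W x₀
      = ∫ _ in ball x₀ ρ, 2 * n * ρ ^ 2 * (2 * ρ ^ 2) ^ (-((n : ℝ) / 2) - 1) * (W x₀ / 2) := by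
        rw [setIntegral_const, smul_eq_mul, hvol, ← hscale]
        ring
    _ ≤ ∫ y in ball x₀ ρ,
          2 * n * ρ ^ 2 * (‖y - x₀‖ ^ 2 + ρ ^ 2) ^ (-((n : ℝ) / 2) - 1) * W y := by
        refine setIntegral_mono_on (integrableOn_const measure_ball_lt_top.ne) h_int.integrableOn
          measurableSet_ball fun y hy => ?_
        rw [mem_ball, dist_eq_norm] at hy
        have h1 : W x₀ / 2 ≤ W y :=
          (hball (by rw [dist_eq_norm]; exact hy.trans_le (min_le_left _ _))).le
        have h2 : (2 * ρ ^ 2) ^ (-((n : ℝ) / 2) - 1) ≤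
            (‖y - x₀‖ ^ 2 + ρ ^ 2) ^ (-((n : ℝ) / 2) - 1) := by
          refine Real.rpow_le_rpow_of_nonpos (hpos hε y) ?_ ?_
          · nlinarith [norm_nonneg (y - x₀)]
          · have : (0 : ℝ) ≤ n := n.cast_nonneg
            linarith
        have h3 : (0 : ℝ) ≤ 2 * n * ρ ^ 2 := by positivity
        have h4 : (0 : ℝ) ≤ (2 * ρ ^ 2) ^ (-((n : ℝ) / 2) - 1) := by positivity
        exact mul_le_mul (mul_le_mul_of_nonneg_left h2 h3) h1 (by linarith)
          (mul_nonneg h3 (h4.trans h2))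
    _ ≤ _ := setIntegral_le_integral h_int (Eventually.of_forall (hnn hε))

theorem exists_pointwise_bound (hn : 1 ≤ n) {Ω : Set (EuclideanSpace ℝ (Fin n))}
    (hΩ : IsOpen Ω) (hb : IsBounded Ω) {p : ℝ} (hp1 : 1 < p) (hpn : (n : ℝ) / 2 < p) :
    ∃ C : ℝ, 0 ≤ C ∧ ∀ W k : EuclideanSpace ℝ (Fin n) → ℝ, ContDiff ℝ 2 W →
      HasCompactSupport W → tsupport W ⊆ Ω → (∀ x, 0 ≤ W x) → (∀ x ∈ Ω, 0 ≤ k x) →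
      (∀ x ∈ Ω, -lap W x ≤ k x) → IntegrableOn (fun x => k x ^ p) Ω →
      ∀ x ∈ Ω, W x ≤ C * (1 + ∫ y in Ω, k y ^ p) := by
  have hn0 : (1 : ℝ) ≤ n := by exact_mod_cast hn
  obtain ⟨R, hR⟩ := hb.subset_ball (0 : EuclideanSpace ℝ (Fin n))
  let q := p / (p - 1)
  have hpq : q.HolderConjugate p := (Real.HolderConjugate.conjExponent hp1).symm
  have hq1 : 1 < q := hpq.lt
  have hq0 : 0 < q := one_pos.trans hq1
  have hp0 : 0 < p := one_pos.trans hp1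
  obtain ⟨a, ha1, ha2⟩ : ∃ a, max 0 ((n : ℝ) / 2 - 1) < a ∧ a < n / (2 * q) := by
    refine exists_between (max_lt (by positivity) ?_)
    have : (n : ℝ) / (2 * q) = n / 2 - n / 2 / p := by
      have : p - 1 ≠ 0 := by linarith
      simp only [q]
      field_simp
    rw [this]
    have := (div_lt_one hp0).2 hpn
    linarith
  have ha0 : 0 < a := (le_max_left _ _).trans_lt ha1
  have haα : (n : ℝ) / 2 - 1 < a := (le_max_right _ _).trans_lt ha1
  have haq : 2 * a * q < n := by
    rw [lt_div_iff₀ (by positivity)] at ha2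
    linarith
  let S := 4 * R ^ 2 + 1
  have hS : 0 < S := by positivity
  let M := S ^ (a - (n : ℝ) / 2 + 1) / (a - (n : ℝ) / 2 + 1)
  have hM : 0 ≤ M := div_nonneg (Real.rpow_nonneg hS.le _) (by linarith)
  let G : EuclideanSpace ℝ (Fin n) → ℝ := fun z => (M * (‖z‖ ^ 2) ^ (-a)) ^ q
  have hG0 : ∀ z, 0 ≤ G z := fun z => Real.rpow_nonneg (mul_nonneg hM (by positivity)) _
  have hGloc : LocallyIntegrable G := by
    refine locallyIntegrable_of_norm_le_rpow (C := M ^ q) (α := 2 * a * q)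
      (by simpa using hn) (by simpa using haq) (Eventually.of_forall fun z => ?_) ?_
    · rw [Real.norm_of_nonneg (hG0 z)]
      refine le_of_eq ?_
      simp only [G]
      rw [Real.mul_rpow hM (by positivity), ← Real.rpow_natCast, ← Real.rpow_mul (norm_nonneg _),
        ← Real.rpow_mul (norm_nonneg _)]
      congr 2
      push_cast
      ring
    · refine Measurable.aestronglyMeasurable ?_
      fun_prop
  have hGint : IntegrableOn G (ball 0 (2 * R)) :=
    (hGloc.integrableOn_isCompact (isCompact_closedBall 0 (2 * R))).mono_set ball_subset_closedBall
  let J := ∫ z in ball 0 (2 * R), G z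
  have hJ : 0 ≤ J := integral_nonneg hG0
  let c := n * 2 ^ (-((n : ℝ) / 2) - 1) * volume.real (ball (0 : EuclideanSpace ℝ (Fin n)) 1)
  have hV : 0 < volume.real (ball (0 : EuclideanSpace ℝ (Fin n)) 1) :=
    ENNReal.toReal_pos (measure_ball_pos _ _ one_pos).ne' measure_ball_lt_top.ne
  have hc : 0 < c := by positivity
  refine ⟨(J + 1) / c, by positivity, fun W k hW hWc hWΩ hW0 hk0 hk hkp x₀ hx₀ => ?_⟩
  obtain ⟨ε, hε, hε1, hlow⟩ := exists_le_integral_approx_identity hn hW.continuous hWc hW0 x₀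
  rw [← integral_regKernel_mul_lap hS hε x₀ hW hWc] at hlow
  have hx₀R : ‖x₀‖ < R := by simpa using hR hx₀
  have hdist : ∀ y ∈ Ω, ‖y - x₀‖ < 2 * R := fun y hy => by
    have : ‖y‖ < R := by simpa using hR hy
    linarith [norm_sub_le y x₀]
  have hGx : IntegrableOn (fun y => G (y - x₀)) Ω := by
    have h : IntegrableOn (fun y => G (y - x₀)) ((fun y => y - x₀) ⁻¹' ball 0 (2 * R)) :=
      ((measurePreserving_sub_right volume x₀).integrableOn_comp_preimage
        (Homeomorph.subRight x₀).measurableEmbedding).2 hGint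
    exact h.mono_set fun y hy => by simpa using hdist y hy
  have hGxJ : ∫ y in Ω, G (y - x₀) ≤ J := by
    have h := (measurePreserving_sub_right volume x₀).setIntegral_preimage_emb
      (Homeomorph.subRight x₀).measurableEmbedding G (ball 0 (2 * R))
    simp only [J]
    rw [← h]
    refine setIntegral_mono_set ?_ (Eventually.of_forall fun y => hG0 _)
      (LE.le.eventuallyLE fun y hy => by simpa using hdist y hy)
    exact ((measurePreserving_sub_right volume x₀).integrableOn_comp_preimage
        (Homeomorph.subRight x₀).measurableEmbedding).2 hGint
  have hlap : ∀ y ∉ Ω, lap W y = 0 := fun y hy => by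
    have hy' : y ∉ tsupport W := fun h => hy (hWΩ h)
    refine Finset.sum_eq_zero fun i _ => ?_
    rw [image_eq_zero_of_notMem_tsupport (f := fun x => fderiv ℝ
      (fun y => fderiv ℝ W y (EuclideanSpace.single i 1)) x (EuclideanSpace.single i 1))]
    intro h
    exact hy' (tsupport_fderiv_apply_subset ℝ _ (tsupport_fderiv_apply_subset ℝ _ h))
  have hset : ∫ y, regKernel S ε x₀ y * -lap W y = ∫ y in Ω, regKernel S ε x₀ y * -lap W y :=
    (setIntegral_eq_integral_of_forall_compl_eq_zero fun y hy => by simp [hlap y hy]).symm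
  have hlapc : Continuous (lap W) := continuous_finsetSum _ fun i _ =>
    (((hW.fderiv_right (m := 1) (by norm_num)).clm_apply contDiff_const).continuous_fderiv
      one_ne_zero).clm_apply continuous_const
  have hlapK : HasCompactSupport (lap W) :=
    HasCompactSupport.intro hWc fun y hy => by
      refine Finset.sum_eq_zero fun i _ => ?_
      rw [image_eq_zero_of_notMem_tsupport (f := fun x => fderiv ℝ
        (fun y => fderiv ℝ W y (EuclideanSpace.single i 1)) x (EuclideanSpace.single i 1))]
      intro h
      exact hy (tsupport_fderiv_apply_subset ℝ _ (tsupport_fderiv_apply_subset ℝ _ h))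
  have hleft : Integrable fun y => regKernel S ε x₀ y * -lap W y :=
    ((contDiff_regKernel hS hε x₀).continuous.mul hlapc.neg).integrable_of_hasCompactSupport
      (hlapK.neg.mul_left)
  have hup : ∫ y in Ω, regKernel S ε x₀ y * -lap W y ≤
      ∫ y in Ω, (G (y - x₀) / q + k y ^ p / p) := by
    refine integral_mono_ae hleft.integrableOn ((hGx.div_const q).add (hkp.div_const p)) ?_
    have : NeZero n := ⟨by omega⟩
    have hne : ∀ᵐ y ∂(volume.restrict Ω), y ≠ x₀ :=
      ae_restrict_of_ae (Measure.ae_ne volume x₀)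
    filter_upwards [hne, ae_restrict_mem hΩ.measurableSet] with y hy hyΩ
    have hr : 0 < ‖y - x₀‖ := norm_pos_iff.2 (sub_ne_zero.2 hy)
    have hs : 0 < ‖y - x₀‖ ^ 2 + ε := by positivity
    have hsS : ‖y - x₀‖ ^ 2 + ε ≤ S := by
      have := hdist y hyΩ
      simp only [S]
      nlinarith
    have hΓ0 : 0 ≤ regKernel S ε x₀ y := radialProfile_nonneg hs hsS
    have hΓ : regKernel S ε x₀ y ≤ M * (‖y - x₀‖ ^ 2) ^ (-a) := by
      refine (radialProfile_le hs hsS ha0.le haα).trans (mul_le_mul_of_nonneg_left ?_ hM)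
      exact Real.rpow_le_rpow_of_nonpos (by positivity) (by linarith) (by linarith)
    calc regKernel S ε x₀ y * -lap W y ≤ regKernel S ε x₀ y * k y :=
          mul_le_mul_of_nonneg_left (hk y hyΩ) hΓ0
      _ ≤ M * (‖y - x₀‖ ^ 2) ^ (-a) * k y := mul_le_mul_of_nonneg_right hΓ (hk0 y hyΩ)
      _ ≤ _ := Real.young_inequality_of_nonneg (hΓ0.trans hΓ) (hk0 y hyΩ) hpq
  have hK0 : 0 ≤ ∫ y in Ω, k y ^ p :=
    setIntegral_nonneg hΩ.measurableSet fun y hy => Real.rpow_nonneg (hk0 y hy) _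
  rw [integral_add (hGx.div_const q) (hkp.div_const p), integral_div, integral_div] at hup
  have h1 : (∫ y in Ω, G (y - x₀)) / q ≤ J :=
    (div_le_self (integral_nonneg fun y => hG0 _) hq1.le).trans hGxJ
  have h2 : (∫ y in Ω, k y ^ p) / p ≤ ∫ y in Ω, k y ^ p := div_le_self hK0 hp1.le
  rw [div_mul_eq_mul_div, le_div_iff₀ hc]
  have h3 : c * W x₀ ≤ J + ∫ y in Ω, k y ^ p := by
    calc c * W x₀ ≤ _ := hlow
      _ = _ := hset
      _ ≤ _ := hup
      _ ≤ _ := add_le_add h1 h2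
  nlinarith [mul_nonneg hJ hK0]

end PointwiseBound

section UniformBound

variable {n : ℕ} {Ω : Set (EuclideanSpace ℝ (Fin n))}

theorem lap_indicator_comp {u : EuclideanSpace ℝ (Fin n) → ℝ} (hΩ : IsOpen Ω)
    (hu2 : ContDiffOn ℝ 2 u Ω) (hu1 : ∀ x ∈ Ω, u x < 1) {H h : ℝ → ℝ}
    (hH : ContDiffOn ℝ 1 H (Iio 1)) (hHh : ∀ t < 1, deriv H t = h t)
    (hh : ContDiffOn ℝ 1 h (Iio 1)) {x : EuclideanSpace ℝ (Fin n)} (hx : x ∈ Ω) :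
    lap (Ω.indicator fun y => H (u y)) x =
      deriv h (u x) * ‖fderiv ℝ u x‖ ^ 2 + h (u x) * lap u x := by
  unfold lap
  rw [EuclideanSpace.norm_sq_clm_eq_sum, Finset.mul_sum, Finset.mul_sum, ← Finset.sum_add_distrib]
  refine Finset.sum_congr rfl fun i _ => ?_
  rw [← fderiv_comp_mul_fderiv hΩ hu2 hu1 hh _ hx]
  congr 1
  refine Filter.EventuallyEq.fderiv_eq ?_
  filter_upwards [hΩ.mem_nhds hx] with y hy
  rw [fderiv_indicator_of_isOpen hΩ _ hy, (hasFDerivAt_comp_of_contDiffOn hΩ hu2 hu1 hH hy).fderiv,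
    hHh _ (hu1 y hy)]
  rfl

/-- Uniform bound for stable solutions, given a test function `φ` and a comparison function `H`
blowing up at `1`. -/
theorem exists_uniform_bound_of_test (hn : 1 ≤ n) (hΩ : IsOpen Ω) (hb : IsBounded Ω)
    {f f' : ℝ → ℝ} (hf : ContinuousOn f (Ico 0 1)) (hf' : ContinuousOn f' (Ico 0 1))
    (hf0 : ∀ t ∈ Ico (0 : ℝ) 1, 0 ≤ f t) {c : ℝ} (hc : 0 < c) {φ g H h : ℝ → ℝ}
    (hφ : ContDiffOn ℝ 1 φ (Iio 1)) (hφ0 : ∀ t < c, φ t = 0)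
    (hg : ∀ t < 1, HasDerivAt g (deriv φ t ^ 2) t) (hg0 : ∀ t < c, g t = 0)
    (hH : ∀ t < 1, HasDerivAt H (h t) t) (hH0 : ∀ t < c, H t = 0)
    (hh : ContDiffOn ℝ 1 h (Iio 1)) (hh0 : ∀ t < 1, 0 ≤ h t) (hhm : MonotoneOn h (Iio 1))
    {p A B : ℝ} (hp1 : 1 < p) (hpn : (n : ℝ) / 2 < p) (hB : 0 ≤ B)
    (hineq : ∀ t ∈ Ico (0 : ℝ) 1, (h t * f t) ^ p ≤ A + B * (f' t * φ t ^ 2 - f t * g t))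
    (hunb : ∀ C : ℝ, ∃ t < 1, C < H t) :
    ∃ C : ℝ, C < 1 ∧
      ∀ u : EuclideanSpace ℝ (Fin n) → ℝ,
        ContinuousOn u (closure Ω) → ContDiffOn ℝ 2 u Ω →
        (∀ x ∈ Ω, 0 ≤ u x ∧ u x < 1) →
        (∀ x ∈ Ω, -lap u x = f (u x)) →
        (∀ x ∈ frontier Ω, u x = 0) →
        StableSol f' u Ω →
        ∀ x ∈ Ω, u x ≤ C := by
  obtain ⟨C₀, hC₀, hbound⟩ := exists_pointwise_bound hn hΩ hb hp1 hpn
  obtain ⟨T, hT1, hT⟩ := hunb (C₀ * (1 + A * volume.real Ω))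
  refine ⟨T, hT1, fun u hu hu2 hu1 heq hbd hst x hx => ?_⟩
  have hHmono : MonotoneOn H (Iio 1) := by
    refine monotoneOn_of_deriv_nonneg (convex_Iio 1)
      (fun t ht => (hH t ht).continuousAt.continuousWithinAt) (fun t ht => ?_) (fun t ht => ?_)
    · rw [interior_Iio] at ht
      exact (hH t ht).differentiableAt.differentiableWithinAt
    · rw [interior_Iio] at ht
      rw [(hH t ht).deriv]
      exact hh0 t ht
  have hHnn : ∀ t < 1, 0 ≤ H t := fun t ht => by
    have h1 : min t (c / 2) ∈ Iio (1 : ℝ) := (min_le_left _ _).trans_lt ht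
    rw [← hH0 (min t (c / 2)) ((min_le_right _ _).trans_lt (half_lt_self hc))]
    exact hHmono h1 ht (min_le_left _ _)
  have hu1' : ∀ x ∈ Ω, u x < 1 := fun x hx => (hu1 x hx).2
  have hH2 : ContDiffOn ℝ 2 H (Iio 1) := by
    have : (2 : WithTop ℕ∞) = 1 + 1 := by norm_num
    rw [this, contDiffOn_succ_iff_deriv_of_isOpen isOpen_Iio]
    exact ⟨fun t ht => (hH t ht).differentiableAt.differentiableWithinAt, by simp,
      hh.congr fun t ht => (hH t ht).deriv⟩
  have hdh : ∀ t < 1, 0 ≤ deriv h t := fun t ht => by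
    rw [← derivWithin_of_isOpen isOpen_Iio ht]
    exact hhm.derivWithin_nonneg
  have hhc : ∀ t < c, t < 1 → h t = 0 := fun t ht ht1 => by
    rw [← (hH t ht1).deriv, deriv_eq_zero_of_forall_lt hH0 t ht]
  obtain ⟨hK, hKΩ⟩ := isCompact_superlevel hΩ hb hu hbd hc
  set K := {x ∈ closure Ω | c ≤ u x}
  have zH : ∀ x ∈ Ω, x ∉ K → H (u x) = 0 := eq_zero_of_notMem_superlevel hH0
  have zh : ∀ x ∈ Ω, x ∉ K → h (u x) = 0 := fun x hx hxK =>
    hhc _ (lt_of_not_ge fun h => hxK ⟨subset_closure hx, h⟩) (hu1' x hx)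
  let W := Ω.indicator fun x => H (u x)
  have hW : ContDiff ℝ 2 W :=
    contDiff_indicator_of_compact (k := 2) hΩ hK hKΩ (hH2.comp hu2 hu1') zH
  have hWs : tsupport W ⊆ K := tsupport_indicator_subset_of_compact hK zH
  have hmaps : MapsTo u Ω (Ico 0 1) := hu1
  have hmaps' : MapsTo u Ω (Iio 1) := hu1'
  have hkn : ∀ x ∈ Ω, 0 ≤ h (u x) * f (u x) := fun x hx =>
    mul_nonneg (hh0 _ (hu1' x hx)) (hf0 _ (hu1 x hx))
  have hkc : ContinuousOn (fun x => h (u x) * f (u x)) Ω :=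
    (hh.continuousOn.comp hu2.continuousOn hmaps').mul (hf.comp hu2.continuousOn hmaps)
  have hkp : IntegrableOn (fun x => (h (u x) * f (u x)) ^ p) Ω :=
    integrableOn_of_compact hΩ hK hKΩ (hkc.rpow_const fun x hx => Or.inr (by linarith))
      fun x hx hxK => by
        rw [zh x hx hxK, zero_mul, Real.zero_rpow (by linarith)]
  have hmain := hbound W (fun x => h (u x) * f (u x)) hW
    (hK.of_isClosed_subset (isClosed_tsupport _) hWs) (hWs.trans hKΩ)
    (fun y => indicator_nonneg (fun z hz => hHnn _ (hu1' z hz)) y) hkn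
    (fun y hy => by
      rw [lap_indicator_comp hΩ hu2 hu1' (hH2.of_le (by norm_num)) (fun t ht => (hH t ht).deriv)
        hh hy, ← heq y hy]
      nlinarith [mul_nonneg (hdh _ (hu1' y hy)) (sq_nonneg ‖fderiv ℝ u y‖)])
    hkp x hx
  obtain ⟨hsi, hsn⟩ := hst.integral_comp_nonneg hΩ hb hf hf' hu hbd hu2 hu1 heq hc hφ hφ0 hg hg0
  have hfin : volume Ω ≠ ⊤ := hb.measure_lt_top.ne
  have h_int : ∫ y in Ω, (h (u y) * f (u y)) ^ p ≤ A * volume.real Ω := by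
    calc ∫ y in Ω, (h (u y) * f (u y)) ^ p
        ≤ ∫ y in Ω, (A - B * (f (u y) * g (u y) - f' (u y) * φ (u y) ^ 2)) := by
          refine setIntegral_mono_on hkp ((integrableOn_const hfin).sub (hsi.const_mul B))
            hΩ.measurableSet fun y hy => ?_
          have := hineq _ (hu1 y hy)
          linarith
      _ = A * volume.real Ω - B * ∫ y in Ω, (f (u y) * g (u y) - f' (u y) * φ (u y) ^ 2) := by
          have hcA : Integrable (fun _ => A) (volume.restrict Ω) := integrableOn_const hfin
          rw [integral_sub hcA (hsi.const_mul B), setIntegral_const,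
            integral_const_mul, smul_eq_mul, mul_comm A]
      _ ≤ _ := by nlinarith [mul_nonneg hB hsn]
  by_contra! hlt
  have h1 : H T ≤ H (u x) := hHmono hT1 (hu1' x hx) hlt.le
  have h2 : W x = H (u x) := indicator_of_mem hx _
  have h3 : C₀ * (1 + ∫ y in Ω, (h (u y) * f (u y)) ^ p) ≤ C₀ * (1 + A * volume.real Ω) := by
    gcongr
  linarith

end UniformBound

section Cutoff

/-- A smooth monotone cutoff vanishing on `(-∞, a]` and equal to `1` on `[b, ∞)`. -/
noncomputable def cutoff (a b t : ℝ) : ℝ := Real.smoothTransition ((t - a) / (b - a))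

variable {a b : ℝ}

theorem contDiff_cutoff (a b : ℝ) : ContDiff ℝ 1 (cutoff a b) :=
  Real.smoothTransition.contDiff.comp ((contDiff_id.sub contDiff_const).div_const _)

theorem cutoff_nonneg (a b t : ℝ) : 0 ≤ cutoff a b t := Real.smoothTransition.nonneg _

theorem cutoff_le_one (a b t : ℝ) : cutoff a b t ≤ 1 := Real.smoothTransition.le_one _

theorem cutoff_of_le (hab : a < b) {t : ℝ} (ht : t ≤ a) : cutoff a b t = 0 :=
  Real.smoothTransition.zero_of_nonpos (div_nonpos_of_nonpos_of_nonneg (by linarith) (by linarith))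

theorem cutoff_of_ge (hab : a < b) {t : ℝ} (ht : b ≤ t) : cutoff a b t = 1 :=
  Real.smoothTransition.one_of_one_le ((one_le_div (by linarith)).2 (by linarith))

theorem monotone_cutoff (hab : a < b) : Monotone (cutoff a b) := fun _ _ h =>
  Real.smoothTransition.monotone (div_le_div_of_nonneg_right (by linarith) (by linarith))

theorem contDiffOn_cutoff_mul (hab : a < b) {s : ℝ} (hs : s < a) {q : ℝ → ℝ}
    (hq : ContDiffOn ℝ 1 q (Ioo s 1)) : ContDiffOn ℝ 1 (fun t => cutoff a b t * q t) (Iio 1) := by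
  intro t ht
  refine ContDiffAt.contDiffWithinAt ?_
  rcases lt_or_ge s t with h | h
  · exact (contDiff_cutoff a b).contDiffAt.mul (hq.contDiffAt (Ioo_mem_nhds h ht))
  · refine (contDiffAt_const (c := (0 : ℝ))).congr_of_eventuallyEq ?_
    filter_upwards [Iio_mem_nhds (h.trans_lt hs)] with x hx
    rw [cutoff_of_le hab (le_of_lt hx), zero_mul]

theorem cutoff_mul_nonneg (hab : a < b) {s : ℝ} (hs : s < a) {q : ℝ → ℝ}
    (hq0 : ∀ t ∈ Ioo s 1, 0 ≤ q t) : ∀ t < 1, 0 ≤ cutoff a b t * q t := by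
  intro t ht
  rcases le_or_gt t a with h | h
  · rw [cutoff_of_le hab h, zero_mul]
  · exact mul_nonneg (cutoff_nonneg _ _ _) (hq0 t ⟨hs.trans h, ht⟩)

theorem monotoneOn_cutoff_mul (hab : a < b) {s : ℝ} (hs : s < a) {q : ℝ → ℝ}
    (hq0 : ∀ t ∈ Ioo s 1, 0 ≤ q t) (hq : MonotoneOn q (Ioo s 1)) :
    MonotoneOn (fun t => cutoff a b t * q t) (Iio 1) := by
  intro x hx y hy hxy
  rcases le_or_gt x a with h | h
  · simp only [cutoff_of_le hab h, zero_mul]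
    exact cutoff_mul_nonneg hab hs hq0 y hy
  · exact mul_le_mul (monotone_cutoff hab hxy)
      (hq ⟨hs.trans h, hx⟩ ⟨hs.trans (h.trans_le hxy), hy⟩ hxy) (hq0 x ⟨hs.trans h, hx⟩)
      (cutoff_nonneg _ _ _)

end Cutoff

section Primitive

theorem hasDerivAt_primitive {w : ℝ → ℝ} (hw : ContinuousOn w (Iio 1)) {t : ℝ} (ht : t < 1) :
    HasDerivAt (fun t => ∫ s in (0 : ℝ)..t, w s) (w t) t := by
  refine intervalIntegral.integral_hasDerivAt_right ?_ ?_ (hw.continuousAt (Iio_mem_nhds ht))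
  · refine (hw.mono fun x hx => ?_).intervalIntegrable
    exact hx.2.trans_lt (max_lt one_pos ht)
  · exact hw.stronglyMeasurableAtFilter isOpen_Iio t ht

theorem contDiffOn_primitive {w : ℝ → ℝ} (hw : ContinuousOn w (Iio 1)) :
    ContDiffOn ℝ 1 (fun t => ∫ s in (0 : ℝ)..t, w s) (Iio 1) := by
  have : (1 : WithTop ℕ∞) = 0 + 1 := by norm_num
  rw [this, contDiffOn_succ_iff_deriv_of_isOpen isOpen_Iio]
  refine ⟨fun t ht => (hasDerivAt_primitive hw ht).differentiableAt.differentiableWithinAt,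
    by simp, contDiffOn_zero.2 ?_⟩
  exact hw.congr fun t ht => (hasDerivAt_primitive hw ht).deriv

theorem primitive_eq_zero {w : ℝ → ℝ} {c : ℝ} (hc : 0 < c) (hw : ∀ t < c, w t = 0) :
    ∀ t < c, ∫ s in (0 : ℝ)..t, w s = 0 := by
  intro t ht
  refine intervalIntegral.integral_zero_ae (Eventually.of_forall fun x hx => hw x ?_)
  exact (uIoc_subset_uIcc hx).2.trans_lt (max_lt hc ht)

theorem sub_le_sub_of_hasDerivAt_le {Φ Ψ φ ψ : ℝ → ℝ} {a b : ℝ} (hab : a ≤ b)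
    (hΦ : ∀ t ∈ Icc a b, HasDerivAt Φ (φ t) t) (hΨ : ∀ t ∈ Icc a b, HasDerivAt Ψ (ψ t) t)
    (h : ∀ t ∈ Icc a b, φ t ≤ ψ t) : Φ b - Φ a ≤ Ψ b - Ψ a := by
  have hd : ∀ t ∈ Icc a b, HasDerivAt (Ψ - Φ) (ψ t - φ t) t := fun t ht =>
    (hΨ t ht).sub (hΦ t ht)
  have hm : MonotoneOn (Ψ - Φ) (Icc a b) := by
    refine monotoneOn_of_deriv_nonneg (convex_Icc a b)
      (fun t ht => (hd t ht).continuousAt.continuousWithinAt)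
      (fun t ht => (hd t (interior_subset ht)).differentiableAt.differentiableWithinAt)
      fun t ht => ?_
    rw [(hd t (interior_subset ht)).deriv]
    linarith [h t (interior_subset ht)]
  have := hm (left_mem_Icc.2 hab) (right_mem_Icc.2 hab) hab
  simp only [Pi.sub_apply] at this
  linarith

end Primitive

section UniformBound

variable {n : ℕ} {Ω : Set (EuclideanSpace ℝ (Fin n))}

/-- Reduction of the uniform bound to an inequality near `1` for the nonlinearity. -/
theorem exists_uniform_bound_of_profile (hn : 1 ≤ n) (hΩ : IsOpen Ω) (hb : IsBounded Ω)
    {f f' : ℝ → ℝ} (hf : ContinuousOn f (Ico 0 1)) (hf' : ContinuousOn f' (Ico 0 1))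
    (hf0 : ∀ t ∈ Ico (0 : ℝ) 1, 0 ≤ f t) {s a b : ℝ} (ha0 : 0 < a) (hsa : s < a) (hab : a < b)
    (hb1 : b < 1) {φ q : ℝ → ℝ} (hφ : ContDiffOn ℝ 1 φ (Iio 1)) (hφ0 : ∀ t < a, φ t = 0)
    (hq : ContDiffOn ℝ 1 q (Ioo s 1)) (hq0 : ∀ t ∈ Ioo s 1, 0 ≤ q t)
    (hqm : MonotoneOn q (Ioo s 1)) {p A B T : ℝ} (hp1 : 1 < p) (hpn : (n : ℝ) / 2 < p)
    (hB : 0 ≤ B) (hbT : b ≤ T) (hT1 : T < 1)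
    (hineq : ∀ t ∈ Ico T 1, (q t * f t) ^ p ≤
      A + B * (f' t * φ t ^ 2 - f t * ∫ s in (0 : ℝ)..t, deriv φ s ^ 2))
    (hunb : ∀ Q : ℝ → ℝ, (∀ t ∈ Ico b 1, HasDerivAt Q (q t) t) → ∀ C : ℝ, ∃ t ∈ Ico b 1, C < Q t) :
    ∃ C : ℝ, C < 1 ∧
      ∀ u : EuclideanSpace ℝ (Fin n) → ℝ,
        ContinuousOn u (closure Ω) → ContDiffOn ℝ 2 u Ω →
        (∀ x ∈ Ω, 0 ≤ u x ∧ u x < 1) →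
        (∀ x ∈ Ω, -lap u x = f (u x)) →
        (∀ x ∈ frontier Ω, u x = 0) →
        StableSol f' u Ω →
        ∀ x ∈ Ω, u x ≤ C := by
  have hh := contDiffOn_cutoff_mul hab hsa hq
  have hhc := hh.continuousOn
  have hh0 : ∀ t < a, cutoff a b t * q t = 0 := fun t ht => by
    rw [cutoff_of_le hab ht.le, zero_mul]
  have hdφ : ContinuousOn (fun t => deriv φ t ^ 2) (Iio 1) :=
    (hφ.continuousOn_deriv_of_isOpen isOpen_Iio le_rfl).pow 2
  have hdφ0 : ∀ t < a, deriv φ t ^ 2 = 0 := fun t ht => by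
    rw [deriv_eq_zero_of_forall_lt hφ0 t ht]; norm_num
  let h := fun t => cutoff a b t * q t
  let g := fun t => ∫ s in (0 : ℝ)..t, deriv φ s ^ 2
  obtain ⟨A', hA'⟩ : ∃ A', ∀ t ∈ Ico (0 : ℝ) 1, t ≤ T →
      (h t * f t) ^ p - B * (f' t * φ t ^ 2 - f t * g t) ≤ A' := by
    have hs1 : Icc 0 T ⊆ Iio 1 := fun t ht => ht.2.trans_lt hT1
    have hs2 : Icc 0 T ⊆ Ico 0 1 := fun t ht => ⟨ht.1, ht.2.trans_lt hT1⟩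
    have hcont : ContinuousOn
        (fun t => (h t * f t) ^ p - B * (f' t * φ t ^ 2 - f t * g t)) (Icc 0 T) := by
      have c1 := hhc.mono hs1
      have c2 := hf.mono hs2
      have c3 := hf'.mono hs2
      have c4 := hφ.continuousOn.mono hs1
      have c5 := (contDiffOn_primitive hdφ).continuousOn.mono hs1
      refine ContinuousOn.sub ((c1.mul c2).rpow_const fun t _ => Or.inr (by linarith)) ?_
      exact continuousOn_const.mul ((c3.mul (c4.pow 2)).sub (c2.mul c5))
    obtain ⟨A', hA'⟩ := isCompact_Icc.bddAbove_image hcont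
    exact ⟨A', fun t ht htT => hA' ⟨t, ⟨ht.1, htT⟩, rfl⟩⟩
  refine exists_uniform_bound_of_test hn hΩ hb hf hf' hf0 ha0 hφ hφ0
    (fun t ht => hasDerivAt_primitive hdφ ht) (primitive_eq_zero ha0 hdφ0)
    (fun t ht => hasDerivAt_primitive hhc ht) (primitive_eq_zero ha0 hh0) hh
    (cutoff_mul_nonneg hab hsa hq0) (monotoneOn_cutoff_mul hab hsa hq0 hqm) hp1 hpn
    (A := max A A') hB (fun t ht => ?_) fun C => ?_
  · rcases le_or_gt t T with htT | htT
    · have := hA' t ht htT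
      simp only [h, g] at this
      linarith [le_max_right A A']
    · have := hineq t ⟨htT.le, ht.2⟩
      rw [cutoff_of_ge hab (hbT.trans htT.le), one_mul]
      linarith [le_max_left A A']
  · obtain ⟨t, ht, hCt⟩ := hunb (fun t => ∫ s in (0 : ℝ)..t, cutoff a b s * q s)
      (fun t ht => by
        have := hasDerivAt_primitive hhc ht.2
        rwa [cutoff_of_ge hab ht.1, one_mul] at this) C
    exact ⟨t, ht.2, hCt⟩

end UniformBound

section Nonlinearity

theorem exists_Ico_of_eventually_nhdsLT {P : ℝ → Prop} (h : ∀ᶠ t in 𝓝[<] (1 : ℝ), P t) :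
    ∃ a ∈ Ioo (0 : ℝ) 1, ∀ t ∈ Ico a 1, P t := by
  obtain ⟨l, hl, hsub⟩ := mem_nhdsLT_iff_exists_Ico_subset.1 h
  refine ⟨max l (1 / 2), ⟨by positivity, max_lt hl (by norm_num)⟩, fun t ht => ?_⟩
  exact hsub ⟨(le_max_left _ _).trans ht.1, ht.2⟩

theorem tendsto_nhdsLT_atTop_of_monotoneOn {f : ℝ → ℝ} (hf : MonotoneOn f (Ico 0 1))
    (h : ∀ M, ∃ t ∈ Ico (0 : ℝ) 1, M ≤ f t) : Tendsto f (𝓝[<] 1) atTop := by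
  refine tendsto_atTop.2 fun M => ?_
  obtain ⟨t, ht, hM⟩ := h M
  filter_upwards [Ico_mem_nhdsLT ht.2] with s hs
  exact hM.trans (hf ht ⟨ht.1.trans hs.1, hs.2⟩ hs.1)

variable {f f' f'' : ℝ → ℝ}

theorem C2On01.hasDerivAt (h : C2On01 f f' f'') {t : ℝ} (ht : t ∈ Ioo (0 : ℝ) 1) :
    HasDerivAt f (f' t) t :=
  (h.1 t (Ioo_subset_Ico_self ht)).hasDerivAt (Ico_mem_nhds ht.1 ht.2)

theorem C2On01.hasDerivAt_deriv (h : C2On01 f f' f'') {t : ℝ} (ht : t ∈ Ioo (0 : ℝ) 1) :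
    HasDerivAt f' (f'' t) t :=
  (h.2.1 t (Ioo_subset_Ico_self ht)).hasDerivAt (Ico_mem_nhds ht.1 ht.2)

theorem C2On01.continuousOn (h : C2On01 f f' f'') : ContinuousOn f (Ico 0 1) :=
  fun t ht => (h.1 t ht).continuousWithinAt

theorem C2On01.continuousOn_deriv (h : C2On01 f f' f'') : ContinuousOn f' (Ico 0 1) :=
  fun t ht => (h.2.1 t ht).continuousWithinAt

theorem monotoneOn_Ico_of_hasDerivAt {f f' : ℝ → ℝ} (hc : ContinuousOn f (Ico 0 1))
    (hd : ∀ t ∈ Ioo (0 : ℝ) 1, HasDerivAt f (f' t) t) (h0 : ∀ t ∈ Ico (0 : ℝ) 1, 0 ≤ f' t) :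
    MonotoneOn f (Ico 0 1) := by
  refine monotoneOn_of_deriv_nonneg (convex_Ico 0 1) hc (fun t ht => ?_) fun t ht => ?_
  · rw [interior_Ico] at ht
    exact (hd t ht).differentiableAt.differentiableWithinAt
  · rw [interior_Ico] at ht
    rw [(hd t ht).deriv]
    exact h0 t (Ioo_subset_Ico_self ht)

theorem contDiffOn_one_Ioo_of_hasDerivAt {f f' : ℝ → ℝ}
    (hd : ∀ t ∈ Ioo (0 : ℝ) 1, HasDerivAt f (f' t) t) (hc : ContinuousOn f' (Ico 0 1)) :
    ContDiffOn ℝ 1 f (Ioo 0 1) := by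
  have : (1 : WithTop ℕ∞) = 0 + 1 := by norm_num
  rw [this, contDiffOn_succ_iff_deriv_of_isOpen isOpen_Ioo]
  refine ⟨fun t ht => (hd t ht).differentiableAt.differentiableWithinAt, by simp,
    contDiffOn_zero.2 ?_⟩
  exact (hc.mono Ioo_subset_Ico_self).congr fun t ht => (hd t ht).deriv

theorem C2On01.contDiffOn (h : C2On01 f f' f'') : ContDiffOn ℝ 1 f (Ioo 0 1) :=
  contDiffOn_one_Ioo_of_hasDerivAt (fun _ ht => h.hasDerivAt ht) h.continuousOn_deriv

theorem C2On01.contDiffOn_deriv (h : C2On01 f f' f'') : ContDiffOn ℝ 1 f' (Ioo 0 1) :=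
  contDiffOn_one_Ioo_of_hasDerivAt (fun _ ht => h.hasDerivAt_deriv ht) h.2.2

theorem hasDerivAt_integral_Ico {f : ℝ → ℝ} (hf : ContinuousOn f (Ico 0 1)) {t : ℝ}
    (ht : t ∈ Ioo (0 : ℝ) 1) : HasDerivAt (fun t => ∫ s in (0 : ℝ)..t, f s) (f t) t := by
  refine intervalIntegral.integral_hasDerivAt_right ?_ ?_
    (hf.continuousAt (Ico_mem_nhds ht.1 ht.2))
  · refine (hf.mono fun x hx => ?_).intervalIntegrable
    rw [uIcc_of_le ht.1.le] at hx
    exact ⟨hx.1, hx.2.trans_lt ht.2⟩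
  · exact (hf.mono Ioo_subset_Ico_self).stronglyMeasurableAtFilter isOpen_Ioo t ht

theorem tendsto_atTop_of_tendsto_integral {f : ℝ → ℝ} (hf : ContinuousOn f (Ico 0 1))
    (hf0 : ∀ t ∈ Ico (0 : ℝ) 1, 0 ≤ f t) (hm : MonotoneOn f (Ico 0 1))
    (hF : Tendsto (fun t => ∫ s in (0 : ℝ)..t, f s) (𝓝[<] 1) atTop) :
    Tendsto f (𝓝[<] 1) atTop := by
  refine tendsto_nhdsLT_atTop_of_monotoneOn hm fun M => ?_
  by_contra! hlt
  obtain ⟨a, ha, hM⟩ := exists_Ico_of_eventually_nhdsLT (hF.eventually_gt_atTop M)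
  have h1 := hM a ⟨le_rfl, ha.2⟩
  have hsub : uIcc 0 a ⊆ Ico 0 1 := fun x hx => by
    rw [uIcc_of_le ha.1.le] at hx
    exact ⟨hx.1, hx.2.trans_lt ha.2⟩
  have hM0 : 0 ≤ M := (hf0 0 (by simp)).trans (hlt 0 (by simp)).le
  have h2 : ∫ s in (0 : ℝ)..a, f s ≤ ∫ _ in (0 : ℝ)..a, M :=
    intervalIntegral.integral_mono_on ha.1.le (hf.mono hsub).intervalIntegrable
      intervalIntegrable_const fun x hx => (hlt x ⟨hx.1, hx.2.trans_lt ha.2⟩).le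
  rw [intervalIntegral.integral_const, smul_eq_mul, sub_zero] at h2
  nlinarith [ha.2]

theorem C2On01.tendsto_deriv_atTop (h : C2On01 f f' f'') (hm : MonotoneOn f' (Ico 0 1))
    (hf : Tendsto f (𝓝[<] 1) atTop) : Tendsto f' (𝓝[<] 1) atTop := by
  refine tendsto_nhdsLT_atTop_of_monotoneOn hm fun M => ?_
  by_contra! hlt
  obtain ⟨a, ha, hM⟩ := exists_Ico_of_eventually_nhdsLT
    (hf.eventually_gt_atTop (f (1 / 2) + |M|))
  let t := max a (1 / 2)
  have ht : t < 1 := max_lt ha.2 (by norm_num)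
  have ht2 : 1 / 2 ≤ t := le_max_right _ _
  have h1 := hM t ⟨le_max_left _ _, ht⟩
  have h2 := sub_le_sub_of_hasDerivAt_le (Φ := f) (Ψ := fun t => M * t) (ψ := fun _ => M) ht2
    (fun x hx => h.hasDerivAt ⟨by linarith [hx.1], hx.2.trans_lt ht⟩)
    (fun x _ => by simpa using (hasDerivAt_id x).const_mul M)
    (fun x hx => (hlt x ⟨by linarith [hx.1], hx.2.trans_lt ht⟩).le)
  have h3 : M * (t - 1 / 2) ≤ |M| := by
    have := le_abs_self M
    nlinarith [abs_nonneg M]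
  linarith

/-- Differential form of the concavity of `f ^ (-θ)`. -/
theorem C2On01.mul_deriv_ge_of_concaveOn (h : C2On01 f f' f'') {θ t₀ : ℝ} (hθ : 0 < θ)
    (hconc : ConcaveOn ℝ (Ico t₀ 1) fun t => f t ^ (-θ)) {s : ℝ} (hs0 : 0 < s) (hs : t₀ < s)
    (hpos : ∀ t ∈ Ico s 1, 0 < f t) :
    ∀ t ∈ Ioo s 1, (1 + θ) * f' t ^ 2 ≤ f t * f'' t := by
  have hd : ∀ t ∈ Ioo s 1,
      HasDerivAt (fun t => f t ^ (-θ)) (f' t * (-θ) * f t ^ (-θ - 1)) t := fun t ht =>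
    (h.hasDerivAt ⟨hs0.trans ht.1, ht.2⟩).rpow_const (Or.inl (hpos t ⟨ht.1.le, ht.2⟩).ne')
  have hanti : AntitoneOn (deriv fun t => f t ^ (-θ)) (Ioo s 1) :=
    (hconc.subset (fun t ht => ⟨(hs.trans ht.1).le, ht.2⟩) (convex_Ioo s 1)).antitoneOn_deriv
      fun t ht => (hd t ht).differentiableAt
  intro t ht
  have hft := hpos t ⟨ht.1.le, ht.2⟩
  have hev : (deriv fun t => f t ^ (-θ)) =ᶠ[𝓝 t] fun t => f' t * (-θ) * f t ^ (-θ - 1) := by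
    filter_upwards [Ioo_mem_nhds ht.1 ht.2] with x hx using (hd x hx).deriv
  have hd2 : HasDerivAt (fun t => f' t * (-θ) * f t ^ (-θ - 1))
      (f'' t * (-θ) * f t ^ (-θ - 1) +
        f' t * (-θ) * (f' t * (-θ - 1) * f t ^ (-θ - 1 - 1))) t :=
    ((h.hasDerivAt_deriv ⟨hs0.trans ht.1, ht.2⟩).mul_const (-θ)).mul
      ((h.hasDerivAt ⟨hs0.trans ht.1, ht.2⟩).rpow_const (Or.inl hft.ne'))
  have hle : deriv (deriv fun t => f t ^ (-θ)) t ≤ 0 := by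
    rw [← derivWithin_of_isOpen isOpen_Ioo ht]
    exact hanti.derivWithin_nonpos
  rw [hev.deriv_eq, hd2.deriv, Real.rpow_sub_one hft.ne' (-θ - 1)] at hle
  have hr : 0 < f t ^ (-θ - 1) := Real.rpow_pos_of_pos hft _
  have hfac : f'' t * (-θ) * f t ^ (-θ - 1) +
      f' t * (-θ) * (f' t * (-θ - 1) * (f t ^ (-θ - 1) / f t)) =
      θ * f t ^ (-θ - 1) / f t * ((1 + θ) * f' t ^ 2 - f t * f'' t) := by
    field_simp
    ring
  rw [hfac] at hle
  have := nonpos_of_mul_nonpos_right hle (by positivity)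
  linarith

end Nonlinearity

section LowDimension

variable {f f' f'' : ℝ → ℝ}

theorem C2On01.exists_lt_primitive_rpow_deriv (h : C2On01 f f' f'')
    (hf0 : ∀ t ∈ Ico (0 : ℝ) 1, 0 ≤ f t) (hm : MonotoneOn f' (Ico 0 1))
    (hF : Tendsto (fun t => ∫ s in (0 : ℝ)..t, f s) (𝓝[<] 1) atTop) {b : ℝ}
    (hb : b ∈ Ioo (0 : ℝ) 1) (hf1 : ∀ t ∈ Ico b 1, 1 ≤ f' t) {Q : ℝ → ℝ}
    (hQ : ∀ t ∈ Ico b 1, HasDerivAt Q (f' t ^ (2 / 3 : ℝ)) t) (C : ℝ) : ∃ t ∈ Ico b 1, C < Q t := by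
  by_contra! hC
  have hq1 : ∀ t ∈ Ico b 1, 1 ≤ f' t ^ (2 / 3 : ℝ) := fun t ht =>
    Real.one_le_rpow (hf1 t ht) (by norm_num)
  have hQm : ∀ s t, b ≤ s → s ≤ t → t < 1 → (t - s) * f' s ^ (2 / 3 : ℝ) ≤ Q t - Q s := by
    intro s t hs hst ht
    have := sub_le_sub_of_hasDerivAt_le (Φ := fun x => x * f' s ^ (2 / 3 : ℝ)) hst
      (fun x _ => by simpa using (hasDerivAt_id x).mul_const (f' s ^ (2 / 3 : ℝ)))
      (fun x hx => hQ x ⟨hs.trans hx.1, hx.2.trans_lt ht⟩) fun x hx => by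
        have hx1 := hx.2.trans_lt ht
        exact Real.rpow_le_rpow (by linarith [hf1 s ⟨hs, hst.trans_lt ht⟩])
          (hm ⟨by linarith [hb.1], hst.trans_lt ht⟩ ⟨by linarith [hb.1, hx.1], hx1⟩ hx.1)
          (by norm_num)
    linarith
  let D := C - Q b
  have hD : 0 ≤ D := by
    have := hC b ⟨le_rfl, hb.2⟩
    simp only [D]
    linarith
  have hbd : ∀ s ∈ Ico b 1, (1 - s) * f' s ^ (2 / 3 : ℝ) ≤ D := by
    intro s hs
    have hlim : Tendsto (fun t => (t - s) * f' s ^ (2 / 3 : ℝ)) (𝓝[<] 1)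
        (𝓝 ((1 - s) * f' s ^ (2 / 3 : ℝ))) := by
      refine Tendsto.mono_left ?_ nhdsWithin_le_nhds
      exact Continuous.tendsto (by fun_prop) 1
    refine le_of_tendsto hlim ?_
    filter_upwards [Ico_mem_nhdsLT hs.2] with t ht
    have h1 := hQm s t hs.1 ht.1 ht.2
    have h2 := hQm b s le_rfl hs.1 hs.2
    have h3 := hC t ⟨hs.1.trans ht.1, ht.2⟩
    have h4 : 0 ≤ (s - b) * f' b ^ (2 / 3 : ℝ) :=
      mul_nonneg (by linarith [hs.1]) (by linarith [hq1 b ⟨le_rfl, hb.2⟩])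
    simp only [D]
    linarith
  have hsq : ∀ s ∈ Ico b 1, (1 - s) * f' s ≤ D * f' s ^ (2 / 3 : ℝ) := by
    intro s hs
    have h1 : f' s ≤ f' s ^ (2 / 3 : ℝ) * f' s ^ (2 / 3 : ℝ) := by
      rw [← Real.rpow_add (by linarith [hf1 s hs])]
      exact Real.self_le_rpow_of_one_le (hf1 s hs) (by norm_num)
    have h2 := hbd s hs
    have h3 : 0 ≤ 1 - s := by linarith [hs.2]
    nlinarith [hq1 s hs, mul_le_mul_of_nonneg_left h1 h3]
  let F := fun t => ∫ s in (0 : ℝ)..t, f s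
  have hFle : ∀ t ∈ Ico b 1, F t ≤ F b + (1 - b) * f b + D * D := by
    intro t ht
    have h1 := sub_le_sub_of_hasDerivAt_le (Φ := fun t => F t + (1 - t) * f t)
      (Ψ := fun t => D * Q t) (φ := fun t => (1 - t) * f' t) ht.1
      (fun x hx => by
        have hx' : x ∈ Ioo (0 : ℝ) 1 := ⟨hb.1.trans_le hx.1, hx.2.trans_lt ht.2⟩
        have := (hasDerivAt_integral_Ico h.continuousOn hx').add
          (((hasDerivAt_id x).const_sub 1).mul (h.hasDerivAt hx'))
        refine this.congr_deriv ?_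
        simp)
      (fun x hx => (hQ x ⟨hx.1, hx.2.trans_lt ht.2⟩).const_mul D)
      (fun x hx => hsq x ⟨hx.1, hx.2.trans_lt ht.2⟩)
    have h2 : 0 ≤ (1 - t) * f t :=
      mul_nonneg (by linarith [ht.2]) (hf0 t ⟨by linarith [hb.1, ht.1], ht.2⟩)
    have h3 : D * Q t - D * Q b ≤ D * D := by
      rw [← mul_sub]
      refine mul_le_mul_of_nonneg_left ?_ hD
      have := hC t ht
      simp only [D]
      linarith
    linarith
  obtain ⟨a, ha, hgt⟩ := exists_Ico_of_eventually_nhdsLT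
    (hF.eventually_gt_atTop (F b + (1 - b) * f b + D * D))
  have hmax : max a b < 1 := max_lt ha.2 hb.2
  exact absurd (hgt _ ⟨le_max_left a b, hmax⟩) (not_lt.2 (hFle _ ⟨le_max_right a b, hmax⟩))

theorem exists_uniform_bound_of_le_two {n : ℕ} (hn : 1 ≤ n) (hn2 : n ≤ 2)
    {Ω : Set (EuclideanSpace ℝ (Fin n))} (hΩ : IsOpen Ω) (hb : IsBounded Ω) (h : C2On01 f f' f'')
    (hf0 : ∀ t ∈ Ico (0 : ℝ) 1, 0 ≤ f t) (hf'0 : ∀ t ∈ Ico (0 : ℝ) 1, 0 ≤ f' t)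
    (hf''0 : ∀ t ∈ Ico (0 : ℝ) 1, 0 ≤ f'' t)
    (hF : Tendsto (fun t => ∫ s in (0 : ℝ)..t, f s) (𝓝[<] 1) atTop) :
    ∃ C : ℝ, C < 1 ∧
      ∀ u : EuclideanSpace ℝ (Fin n) → ℝ,
        ContinuousOn u (closure Ω) → ContDiffOn ℝ 2 u Ω →
        (∀ x ∈ Ω, 0 ≤ u x ∧ u x < 1) →
        (∀ x ∈ Ω, -lap u x = f (u x)) →
        (∀ x ∈ frontier Ω, u x = 0) →
        StableSol f' u Ω →
        ∀ x ∈ Ω, u x ≤ C := by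
  have hmf : MonotoneOn f (Ico 0 1) :=
    monotoneOn_Ico_of_hasDerivAt h.continuousOn (fun _ ht => h.hasDerivAt ht) hf'0
  have hmf' : MonotoneOn f' (Ico 0 1) :=
    monotoneOn_Ico_of_hasDerivAt h.continuousOn_deriv (fun _ ht => h.hasDerivAt_deriv ht) hf''0
  have htf := tendsto_atTop_of_tendsto_integral h.continuousOn hf0 hmf hF
  have htf' := h.tendsto_deriv_atTop hmf' htf
  obtain ⟨s, hs, hs1⟩ := exists_Ico_of_eventually_nhdsLT
    ((htf.eventually_ge_atTop 1).and (htf'.eventually_ge_atTop 1))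
  obtain ⟨a, hsa, ha1⟩ := exists_between hs.2
  obtain ⟨b, hab, hb1⟩ := exists_between ha1
  have ha0 : 0 < a := hs.1.trans hsa
  have hsub : Ioo s 1 ⊆ Ioo 0 1 := Ioo_subset_Ioo_left hs.1.le
  have hsub' : Ioo s 1 ⊆ Ico 0 1 := hsub.trans Ioo_subset_Ico_self
  have hbm : ∀ {t}, t ∈ Ico b 1 → t ∈ Ioo s 1 := fun ht => ⟨(hsa.trans hab).trans_le ht.1, ht.2⟩
  let w := fun t => cutoff a b t * f' t
  have hw : ContDiffOn ℝ 1 w (Iio 1) := contDiffOn_cutoff_mul hab hsa (h.contDiffOn_deriv.mono hsub)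
  have hw0 : ∀ t < a, w t = 0 := fun t ht => by simp only [w, cutoff_of_le hab ht.le, zero_mul]
  have hwb : ∀ t, b ≤ t → w t = f' t := fun t ht => by simp only [w, cutoff_of_ge hab ht, one_mul]
  let φ := fun t => ∫ s in (0 : ℝ)..t, w s
  have hφd : ∀ t < 1, HasDerivAt φ (w t) t := fun t ht => hasDerivAt_primitive hw.continuousOn ht
  have hφ : ContDiffOn ℝ 1 φ (Iio 1) := contDiffOn_primitive hw.continuousOn
  have hφ0 : ∀ t < a, φ t = 0 := primitive_eq_zero ha0 hw0
  have hφd' : ContinuousOn (fun t => deriv φ t ^ 2) (Iio 1) :=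
    (hφ.continuousOn_deriv_of_isOpen isOpen_Iio le_rfl).pow 2
  let g := fun t => ∫ s in (0 : ℝ)..t, deriv φ s ^ 2
  have hgd : ∀ t ∈ Ico b 1, HasDerivAt g (f' t ^ 2) t := fun t ht => by
    have := hasDerivAt_primitive hφd' ht.2
    rwa [(hφd t ht.2).deriv, hwb t ht.1] at this
  have hφf : ∀ t ∈ Ico b 1, HasDerivAt φ (f' t) t := fun t ht => by
    rw [← hwb t ht.1]
    exact hφd t ht.2
  let c := f b - φ b
  have hc : 0 ≤ c := by
    have h1 := sub_le_sub_of_hasDerivAt_le (Φ := φ) (Ψ := f) (hsa.trans hab).le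
      (fun t ht => hφd t (ht.2.trans_lt hb1))
      (fun t ht => h.hasDerivAt ⟨hs.1.trans_le ht.1, ht.2.trans_lt hb1⟩)
      (fun t ht => mul_le_of_le_one_left (by linarith [(hs1 t ⟨ht.1, ht.2.trans_lt hb1⟩).2])
        (cutoff_le_one _ _ _))
    have h2 := (hs1 s ⟨le_rfl, hs.2⟩).1
    rw [hφ0 s hsa] at h1
    simp only [c]
    linarith
  have hφc : ∀ t ∈ Ico b 1, φ t = f t - c := fun t ht => by
    have hd1 : ∀ x ∈ Icc b t, HasDerivAt φ (f' x) x := fun x hx => hφf x ⟨hx.1, hx.2.trans_lt ht.2⟩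
    have hd2 : ∀ x ∈ Icc b t, HasDerivAt f (f' x) x := fun x hx =>
      h.hasDerivAt (hsub (hbm ⟨hx.1, hx.2.trans_lt ht.2⟩))
    have h1 := sub_le_sub_of_hasDerivAt_le ht.1 hd1 hd2 fun _ _ => le_rfl
    have h2 := sub_le_sub_of_hasDerivAt_le ht.1 hd2 hd1 fun _ _ => le_rfl
    simp only [c]
    linarith
  obtain ⟨s₁, hs₁, hs₁'⟩ := exists_Ico_of_eventually_nhdsLT (htf.eventually_ge_atTop (2 * c + 2))
  let r := max s₁ b
  have hr1 : r < 1 := max_lt hs₁.2 hb1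
  have hbr : b ≤ r := le_max_right _ _
  have hφr : c + 2 ≤ φ r := by
    rw [hφc r ⟨hbr, hr1⟩]
    linarith [hs₁' r ⟨le_max_left _ _, hr1⟩]
  obtain ⟨s₂, hs₂, hs₂'⟩ := exists_Ico_of_eventually_nhdsLT
    ((htf.eventually_ge_atTop (2 * f b)).and (htf'.eventually_ge_atTop (g r)))
  let T := max s₂ r
  have hT1 : T < 1 := max_lt hs₂.2 hr1
  have hrT : r ≤ T := le_max_right _ _
  have hn' : (n : ℝ) ≤ 2 := by exact_mod_cast hn2
  refine exists_uniform_bound_of_profile hn hΩ hb h.continuousOn h.continuousOn_deriv hf0 ha0 hsa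
    hab hb1 hφ hφ0 (q := fun t => f' t ^ (2 / 3 : ℝ)) ?_ (fun t ht => ?_) (fun x hx y hy hxy => ?_)
    (p := 6 / 5) (A := 0) (B := 2) (T := T) (by norm_num) (by linarith) (by norm_num)
    (hbr.trans hrT) hT1 (fun t ht => ?_) fun Q hQ C => ?_
  · exact (h.contDiffOn_deriv.mono hsub).rpow_const_of_ne fun t ht =>
      (by linarith [(hs1 t ⟨ht.1.le, ht.2⟩).2] : (0 : ℝ) < f' t).ne'
  · exact Real.rpow_nonneg (hf'0 t (hsub' ht)) _
  · exact Real.rpow_le_rpow (hf'0 x (hsub' hx)) (hmf' (hsub' hx) (hsub' hy) hxy) (by norm_num)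
  · have hrt : r ≤ t := hrT.trans ht.1
    have hbt : t ∈ Ico b 1 := ⟨hbr.trans hrt, ht.2⟩
    have hst := hbm hbt
    obtain ⟨hx1, hy1⟩ := hs1 t ⟨hst.1.le, hst.2⟩
    obtain ⟨hxb, hyg⟩ := hs₂' t ⟨(le_max_left _ _).trans ht.1, ht.2⟩
    have hG := sub_le_sub_of_hasDerivAt_le (Φ := g) (Ψ := fun t => (φ t - φ r) * f' t) hrt
      (fun x hx => hgd x ⟨hbr.trans hx.1, hx.2.trans_lt ht.2⟩)
      (fun x hx => ((hφf x ⟨hbr.trans hx.1, hx.2.trans_lt ht.2⟩).sub_const (φ r)).mul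
        (h.hasDerivAt_deriv (hsub (hbm ⟨hbr.trans hx.1, hx.2.trans_lt ht.2⟩))))
      (fun x hx => by
        have hxb : x ∈ Ico b 1 := ⟨hbr.trans hx.1, hx.2.trans_lt ht.2⟩
        have h1 : φ r ≤ φ x := by
          rw [hφc x hxb, hφc r ⟨hbr, hr1⟩]
          have := hmf (hsub' (hbm ⟨hbr, hr1⟩)) (hsub' (hbm hxb)) hx.1
          linarith
        have h2 := mul_nonneg (sub_nonneg.2 h1) (hf''0 x (hsub' (hbm hxb)))
        nlinarith)
    have hfy := sub_le_sub_of_hasDerivAt_le (Φ := f) (Ψ := fun x => f' t * x)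
      (ψ := fun _ => f' t) hbt.1
      (fun x hx => h.hasDerivAt (hsub (hbm ⟨hx.1, hx.2.trans_lt ht.2⟩)))
      (fun x _ => by simpa using (hasDerivAt_id x).const_mul (f' t))
      (fun x hx => hmf' (hsub' (hbm ⟨hx.1, hx.2.trans_lt ht.2⟩)) (hsub' hst) hx.2)
    have hxy : f t ≤ 2 * f' t := by
      have hb0 : 0 < b := ha0.trans hab
      have h1 : f' t * t - f' t * b ≤ f' t := by nlinarith [ht.2]
      linarith
    have hmain : f t * f' t ≤ f' t * φ t ^ 2 - f t * g t := by
      simp only [sub_self, zero_mul, sub_zero] at hG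
      rw [hφc t hbt] at hG ⊢
      have h1 : g t ≤ f' t * (f t - 2 * c - 1) := by
        nlinarith [mul_le_mul_of_nonneg_right hφr (by linarith : 0 ≤ f' t)]
      have h2 := mul_le_mul_of_nonneg_left h1 (by linarith : 0 ≤ f t)
      nlinarith [mul_nonneg (by linarith : 0 ≤ f' t) (sq_nonneg c)]
    have hpow : (f' t ^ (2 / 3 : ℝ) * f t) ^ (6 / 5 : ℝ) ≤ 2 * (f t * f' t) := by
      have hx0 : 0 < f t := by linarith
      have hy0 : 0 < f' t := by linarith
      calc (f' t ^ (2 / 3 : ℝ) * f t) ^ (6 / 5 : ℝ)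
          = f' t ^ (4 / 5 : ℝ) * (f t * f t ^ (1 / 5 : ℝ)) := by
            rw [Real.mul_rpow (by positivity) hx0.le, ← Real.rpow_mul hy0.le]
            nth_rewrite 2 [← Real.rpow_one (f t)]
            rw [← Real.rpow_add hx0]
            norm_num
        _ ≤ f' t ^ (4 / 5 : ℝ) * (f t * (2 * f' t ^ (1 / 5 : ℝ))) := by
            gcongr
            calc f t ^ (1 / 5 : ℝ) ≤ (2 * f' t) ^ (1 / 5 : ℝ) :=
                  Real.rpow_le_rpow hx0.le hxy (by norm_num)
              _ = 2 ^ (1 / 5 : ℝ) * f' t ^ (1 / 5 : ℝ) := Real.mul_rpow (by norm_num) hy0.le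
              _ ≤ 2 * f' t ^ (1 / 5 : ℝ) := by
                  gcongr
                  exact Real.rpow_le_self_of_one_le (by norm_num) (by norm_num)
        _ = 2 * (f t * (f' t ^ (4 / 5 : ℝ) * f' t ^ (1 / 5 : ℝ))) := by ring
        _ = 2 * (f t * f' t) := by
            rw [← Real.rpow_add hy0]
            norm_num
    linarith
  · exact h.exists_lt_primitive_rpow_deriv hf0 hmf' hF ⟨ha0.trans hab, hb1⟩
      (fun t ht => (hs1 t ⟨(hbm ht).1.le, ht.2⟩).2) hQ C

end LowDimension

section PowerProfile

theorem le_rpow_mul_rpow_of_sq_le {p x y : ℝ} (hp : 2 < p) (hx : 0 < x) (hxy : x ^ 2 ≤ y) :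
    x ≤ y ^ (1 / p) * x ^ (1 - 2 / p) := by
  have h1 : x ^ (2 / p) ≤ y ^ (1 / p) := by
    have h := Real.rpow_le_rpow (by positivity) hxy (by positivity : 0 ≤ 1 / p)
    rwa [← Real.rpow_natCast x 2, ← Real.rpow_mul hx.le, Nat.cast_ofNat, mul_one_div] at h
  calc x = x ^ (2 / p) * x ^ (1 - 2 / p) := by
        rw [← Real.rpow_add hx, add_sub_cancel, Real.rpow_one]
    _ ≤ y ^ (1 / p) * x ^ (1 - 2 / p) := by gcongr

theorem le_mul_rpow_mul_rpow_of_le_sq {p x y z : ℝ} (hp : 2 < p) (hy : 0 < y) (hz : 0 < z)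
    (hyz : y ≤ z ^ 2) (hzx : z / 2 ≤ x) : y ≤ 2 * z * (y ^ (1 / p) * x ^ (1 - 2 / p)) := by
  have hp0 : 0 < p := by linarith
  have hp1 : 0 ≤ 1 - 1 / p := by
    rw [sub_nonneg, div_le_one hp0]
    linarith
  have hp2 : 0 ≤ 1 - 2 / p := by
    rw [sub_nonneg, div_le_one hp0]
    linarith
  have h1 : y ^ (1 - 1 / p) ≤ z * z ^ (1 - 2 / p) := by
    have h := Real.rpow_le_rpow hy.le hyz hp1
    rw [← Real.rpow_natCast z 2, ← Real.rpow_mul hz.le, Nat.cast_ofNat] at h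
    convert h using 1
    nth_rewrite 1 [← Real.rpow_one z]
    rw [← Real.rpow_add hz]
    congr 1
    ring
  have h2 : z ^ (1 - 2 / p) ≤ 2 * x ^ (1 - 2 / p) := by
    calc z ^ (1 - 2 / p) ≤ (2 * x) ^ (1 - 2 / p) :=
          Real.rpow_le_rpow hz.le (by linarith) hp2
      _ = 2 ^ (1 - 2 / p) * x ^ (1 - 2 / p) := Real.mul_rpow (by norm_num) (by linarith)
      _ ≤ 2 * x ^ (1 - 2 / p) := by
          have hx0 : 0 ≤ x := by linarith
          gcongr
          refine Real.rpow_le_self_of_one_le (by norm_num) ?_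
          have : 0 < 2 / p := by positivity
          linarith
  calc y = y ^ (1 / p) * y ^ (1 - 1 / p) := by
        rw [← Real.rpow_add hy, add_sub_cancel, Real.rpow_one]
    _ ≤ y ^ (1 / p) * (z * (2 * x ^ (1 - 2 / p))) := by
        gcongr
        exact h1.trans (by gcongr)
    _ = 2 * z * (y ^ (1 / p) * x ^ (1 - 2 / p)) := by ring

variable {f f' f'' : ℝ → ℝ}

theorem C2On01.exists_lt_primitive_rpow_mul_rpow (h : C2On01 f f' f'')
    (hm : MonotoneOn f' (Ico 0 1)) (htf : Tendsto f (𝓝[<] 1) atTop)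
    (hF : Tendsto (fun t => ∫ s in (0 : ℝ)..t, f s) (𝓝[<] 1) atTop) {b p : ℝ}
    (hb : b ∈ Ioo (0 : ℝ) 1) (hp : 2 < p) (hf1 : ∀ t ∈ Ico b 1, 1 ≤ f t ∧ 1 ≤ f' t) {Q : ℝ → ℝ}
    (hQ : ∀ t ∈ Ico b 1, HasDerivAt Q (f' t ^ (1 / p) * f t ^ (1 - 2 / p)) t) (C : ℝ) :
    ∃ t ∈ Ico b 1, C < Q t := by
  by_cases hcase : ∃ T ∈ Ico b 1, ∀ t ∈ Ico T 1, f t ^ 2 ≤ f' t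
  · obtain ⟨T, hT, hle⟩ := hcase
    obtain ⟨a, ha, hgt⟩ := exists_Ico_of_eventually_nhdsLT
      (hF.eventually_gt_atTop (C - Q T + ∫ s in (0 : ℝ)..T, f s))
    have hr : max a T < 1 := max_lt ha.2 hT.2
    have h1 := hgt _ ⟨le_max_left a T, hr⟩
    have h2 := sub_le_sub_of_hasDerivAt_le (Φ := fun t => ∫ s in (0 : ℝ)..t, f s) (Ψ := Q)
      (le_max_right a T)
      (fun x hx => hasDerivAt_integral_Ico h.continuousOn
        ⟨hb.1.trans_le (hT.1.trans hx.1), hx.2.trans_lt hr⟩)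
      (fun x hx => hQ x ⟨hT.1.trans hx.1, hx.2.trans_lt hr⟩)
      (fun x hx => le_rpow_mul_rpow_of_sq_le hp
        (by linarith [(hf1 x ⟨hT.1.trans hx.1, hx.2.trans_lt hr⟩).1])
        (hle x ⟨hx.1, hx.2.trans_lt hr⟩))
    exact ⟨_, ⟨hT.1.trans (le_max_right a T), hr⟩, by linarith⟩
  · push Not at hcase
    have hQm : ∀ s t, b ≤ s → s ≤ t → t < 1 → Q s ≤ Q t := fun s t hs hst ht => by
      have := sub_le_sub_of_hasDerivAt_le (Φ := fun _ => (0 : ℝ)) hst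
        (fun x _ => hasDerivAt_const x 0)
        (fun x hx => hQ x ⟨hs.trans hx.1, hx.2.trans_lt ht⟩) fun x hx => by
          have := hf1 x ⟨hs.trans hx.1, hx.2.trans_lt ht⟩
          exact mul_nonneg (Real.rpow_nonneg (by linarith) _) (Real.rpow_nonneg (by linarith) _)
      linarith
    have hN : ∀ N : ℕ, ∃ t ∈ Ico b 1, Q b + N / 4 ≤ Q t := by
      intro N
      induction N with
      | zero => exact ⟨b, ⟨le_rfl, hb.2⟩, by simp⟩
      | succ N ih =>
        obtain ⟨t, ht, hQt⟩ := ih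
        obtain ⟨a, ha, hat⟩ := exists_Ico_of_eventually_nhdsLT
          (htf.eventually_ge_atTop (2 * f t))
        obtain ⟨r, hr, hlt⟩ := hcase (max a t) ⟨ht.1.trans (le_max_right _ _), max_lt ha.2 ht.2⟩
        have htr : t ≤ r := (le_max_right _ _).trans hr.1
        have hfr := hat r ⟨(le_max_left _ _).trans hr.1, hr.2⟩
        have hfr1 := (hf1 r ⟨ht.1.trans htr, hr.2⟩).1
        obtain ⟨σ, hσ, hfσ⟩ := intermediate_value_Icc htr
          (h.continuousOn.mono fun x hx =>
            ⟨hb.1.le.trans (ht.1.trans hx.1), hx.2.trans_lt hr.2⟩)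
          (show f r / 2 ∈ Icc (f t) (f r) from ⟨by linarith, by linarith⟩)
        have hbσ : b ≤ σ := ht.1.trans hσ.1
        have hbx : ∀ x ∈ Icc σ r, x ∈ Ico b 1 := fun x hx =>
          ⟨hbσ.trans hx.1, hx.2.trans_lt hr.2⟩
        have h01 : ∀ x ∈ Icc σ r, x ∈ Ioo (0 : ℝ) 1 := fun x hx =>
          ⟨hb.1.trans_le (hbx x hx).1, (hbx x hx).2⟩
        have hinc := sub_le_sub_of_hasDerivAt_le (Φ := f) (Ψ := fun x => 2 * f r * Q x) hσ.2
          (fun x hx => h.hasDerivAt (h01 x hx)) (fun x hx => (hQ x (hbx x hx)).const_mul _)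
          (fun x hx => by
            refine le_mul_rpow_mul_rpow_of_le_sq hp (by linarith [(hf1 x (hbx x hx)).2])
              (by linarith) ?_ ?_
            · exact (hm (Ioo_subset_Ico_self (h01 x hx))
                (Ioo_subset_Ico_self (h01 r ⟨hσ.2, le_rfl⟩)) hx.2).trans hlt.le
            · rw [← hfσ]
              have := sub_le_sub_of_hasDerivAt_le (Φ := fun _ => (0 : ℝ)) (Ψ := f) hx.1
                (fun y _ => hasDerivAt_const y 0)
                (fun y hy => h.hasDerivAt (h01 y ⟨hy.1, hy.2.trans hx.2⟩))
                (fun y hy => by linarith [(hf1 y (hbx y ⟨hy.1, hy.2.trans hx.2⟩)).2])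
              linarith)
        refine ⟨r, ⟨ht.1.trans htr, hr.2⟩, ?_⟩
        have h1 := hQm t σ ht.1 hσ.1 (hσ.2.trans_lt hr.2)
        have h2 : 1 / 4 ≤ Q r - Q σ := by
          rw [hfσ] at hinc
          by_contra! hcon
          nlinarith
        push_cast
        linarith
    obtain ⟨N, hCN⟩ := exists_nat_gt (4 * (C - Q b))
    obtain ⟨t, ht, hQt⟩ := hN N
    exact ⟨t, ht, by linarith⟩

theorem exists_uniform_bound_of_le_six {n : ℕ} (hn : 1 ≤ n) (hn6 : n ≤ 6)
    {Ω : Set (EuclideanSpace ℝ (Fin n))} (hΩ : IsOpen Ω) (hb : IsBounded Ω) (h : C2On01 f f' f'')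
    (hf0 : ∀ t ∈ Ico (0 : ℝ) 1, 0 ≤ f t) (hf'0 : ∀ t ∈ Ico (0 : ℝ) 1, 0 ≤ f' t)
    (hf''0 : ∀ t ∈ Ico (0 : ℝ) 1, 0 ≤ f'' t)
    (hF : Tendsto (fun t => ∫ s in (0 : ℝ)..t, f s) (𝓝[<] 1) atTop)
    {θ t₀ : ℝ} (hθ : 0 < θ) (ht₀ : t₀ < 1)
    (hconc : ConcaveOn ℝ (Ico t₀ 1) fun t => f t ^ (-θ)) :
    ∃ C : ℝ, C < 1 ∧
      ∀ u : EuclideanSpace ℝ (Fin n) → ℝ,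
        ContinuousOn u (closure Ω) → ContDiffOn ℝ 2 u Ω →
        (∀ x ∈ Ω, 0 ≤ u x ∧ u x < 1) →
        (∀ x ∈ Ω, -lap u x = f (u x)) →
        (∀ x ∈ frontier Ω, u x = 0) →
        StableSol f' u Ω →
        ∀ x ∈ Ω, u x ≤ C := by
  have hmf : MonotoneOn f (Ico 0 1) :=
    monotoneOn_Ico_of_hasDerivAt h.continuousOn (fun _ ht => h.hasDerivAt ht) hf'0
  have hmf' : MonotoneOn f' (Ico 0 1) :=
    monotoneOn_Ico_of_hasDerivAt h.continuousOn_deriv (fun _ ht => h.hasDerivAt_deriv ht) hf''0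
  have htf := tendsto_atTop_of_tendsto_integral h.continuousOn hf0 hmf hF
  have htf' := h.tendsto_deriv_atTop hmf' htf
  obtain ⟨s₀, hs₀, hs₀1⟩ := exists_Ico_of_eventually_nhdsLT
    ((htf.eventually_ge_atTop 1).and (htf'.eventually_ge_atTop 1))
  obtain ⟨s, hs, hs1'⟩ := exists_between (max_lt hs₀.2 ht₀)
  have hss₀ : s₀ < s := (le_max_left _ _).trans_lt hs
  have hst₀ : t₀ < s := (le_max_right _ _).trans_lt hs
  have hs0 : 0 < s := hs₀.1.trans hss₀
  have hs1 : ∀ t ∈ Ico s 1, 1 ≤ f t ∧ 1 ≤ f' t := fun t ht => hs₀1 t ⟨hss₀.le.trans ht.1, ht.2⟩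
  obtain ⟨a, hsa, ha1⟩ := exists_between hs1'
  obtain ⟨b, hab, hb1⟩ := exists_between ha1
  obtain ⟨T, hbT, hT1⟩ := exists_between hb1
  have ha0 : 0 < a := hs0.trans hsa
  have hsub : Ioo s 1 ⊆ Ioo 0 1 := Ioo_subset_Ioo_left hs0.le
  have hsub' : Ioo s 1 ⊆ Ico 0 1 := hsub.trans Ioo_subset_Ico_self
  have hsb : s < b := hsa.trans hab
  have hpos : ∀ t ∈ Ioo s 1, 0 < f t := fun t ht => by linarith [(hs1 t ⟨ht.1.le, ht.2⟩).1]
  have hcv := h.mul_deriv_ge_of_concaveOn hθ hconc hs0 hst₀ fun t ht => by linarith [(hs1 t ht).1]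
  obtain ⟨ε, hε0, hε1, hεθ⟩ : ∃ ε : ℝ, 0 < ε ∧ ε ≤ 1 ∧ 4 * ε ≤ θ :=
    ⟨min 1 θ / 4, by positivity, by linarith [min_le_left 1 θ], by linarith [min_le_right 1 θ]⟩
  obtain ⟨β, rfl⟩ : ∃ β : ℝ, ε = β - 2 := ⟨ε + 2, by ring⟩
  have hβθ : 0 < 2 * β + θ := by linarith
  let k := β ^ 2 / (2 * β + θ)
  have hk : k * (2 * β + θ) = β ^ 2 := div_mul_cancel₀ _ hβθ.ne'
  have hk0 : 0 ≤ k := by positivity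
  obtain ⟨κ, hκ0, hκ⟩ : ∃ κ : ℝ, 0 < κ ∧ κ = 1 - k :=
    ⟨1 - k, by
      rw [sub_pos, div_lt_one hβθ]
      nlinarith, rfl⟩
  let φ := fun t => cutoff a b t * f t ^ β
  have hfβ : ∀ c : ℝ, ContDiffOn ℝ 1 (fun t => f t ^ c) (Ioo s 1) := fun c =>
    (h.contDiffOn.mono hsub).rpow_const_of_ne fun t ht => (hpos t ht).ne'
  have hφ : ContDiffOn ℝ 1 φ (Iio 1) := contDiffOn_cutoff_mul hab hsa (hfβ β)
  have hφ0 : ∀ t < a, φ t = 0 := fun t ht => by simp only [φ, cutoff_of_le hab ht.le, zero_mul]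
  have hφb : ∀ t, b ≤ t → φ t = f t ^ β := fun t ht => by
    simp only [φ, cutoff_of_ge hab ht, one_mul]
  have hφd' : ContinuousOn (fun t => deriv φ t ^ 2) (Iio 1) :=
    (hφ.continuousOn_deriv_of_isOpen isOpen_Iio le_rfl).pow 2
  let g := fun t => ∫ s in (0 : ℝ)..t, deriv φ s ^ 2
  have hbm : ∀ {t}, t ∈ Ico b 1 → t ∈ Ioo s 1 := fun ht => ⟨hsb.trans_le ht.1, ht.2⟩
  have hTb : ∀ {t}, t ∈ Ico T 1 → t ∈ Ico b 1 := fun ht => ⟨hbT.le.trans ht.1, ht.2⟩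
  have hgd : ∀ t ∈ Ico T 1, HasDerivAt g (β ^ 2 * f t ^ (2 * β - 2) * f' t ^ 2) t := by
    intro t ht
    have hst := hbm (hTb ht)
    have hd : HasDerivAt φ (f' t * β * f t ^ (β - 1)) t := by
      refine ((h.hasDerivAt (hsub hst)).rpow_const (Or.inl (hpos t hst).ne')).congr_of_eventuallyEq
        ?_
      filter_upwards [Ioi_mem_nhds (hbT.trans_le ht.1)] with x hx using hφb x (mem_Ioi.1 hx).le
    have := hasDerivAt_primitive hφd' ht.2
    rw [hd.deriv] at this
    convert this using 1
    rw [mul_pow, mul_pow, ← Real.rpow_mul_natCast (hpos t hst).le,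
      show (β - 1) * (2 : ℕ) = 2 * β - 2 by push_cast; ring]
    ring
  have hn' : (n : ℝ) ≤ 6 := by exact_mod_cast hn6
  have hp2 : 0 ≤ 1 - 2 / (β + 1) := by
    rw [sub_nonneg, div_le_one (by linarith)]
    linarith
  have hp1 : 0 ≤ 1 / (β + 1) := div_nonneg zero_le_one (by linarith)
  refine exists_uniform_bound_of_profile hn hΩ hb h.continuousOn h.continuousOn_deriv hf0 ha0 hsa
    hab hb1 hφ hφ0 (q := fun t => f' t ^ (1 / (β + 1)) * f t ^ (1 - 2 / (β + 1))) ?_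
    (fun t ht => ?_) (fun x hx y hy hxy => ?_)
    (p := β + 1) (A := g T ^ 2 / κ ^ 2) (B := 2 / κ) (T := T) (by linarith) (by linarith)
    (by positivity) hbT.le hT1 (fun t ht => ?_) fun Q hQ C => ?_
  · refine ((h.contDiffOn_deriv.mono hsub).rpow_const_of_ne fun t ht => ?_).mul (hfβ _)
    exact (by linarith [(hs1 t ⟨ht.1.le, ht.2⟩).2] : (0 : ℝ) < f' t).ne'
  · exact mul_nonneg (Real.rpow_nonneg (hf'0 t (hsub' ht)) _) (Real.rpow_nonneg (hpos t ht).le _)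
  · exact mul_le_mul
      (Real.rpow_le_rpow (hf'0 x (hsub' hx)) (hmf' (hsub' hx) (hsub' hy) hxy) hp1)
      (Real.rpow_le_rpow (hpos x hx).le (hmf (hsub' hx) (hsub' hy) hxy) hp2)
      (Real.rpow_nonneg (hpos x hx).le _) (Real.rpow_nonneg (hf'0 y (hsub' hy)) _)
  · have hst := hbm (hTb ht)
    have hx0 := hpos t hst
    obtain ⟨hx1, hy1⟩ := hs1 t ⟨hst.1.le, hst.2⟩
    have hr : ∀ x ∈ Icc T t, x ∈ Ico T 1 := fun x hx => ⟨hx.1, hx.2.trans_lt ht.2⟩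
    have hG := sub_le_sub_of_hasDerivAt_le (Φ := g)
      (Ψ := fun t => k * (f t ^ (2 * β - 1) * f' t)) ht.1 (fun x hx => hgd x (hr x hx))
      (fun x hx => by
        have hsx := hbm (hTb (hr x hx))
        exact (((h.hasDerivAt (hsub hsx)).rpow_const (Or.inl (hpos x hsx).ne')).mul
          (h.hasDerivAt_deriv (hsub hsx))).const_mul k)
      (fun x hx => by
        have hsx := hbm (hTb (hr x hx))
        have hfx := hpos x hsx
        have h1 : f x ^ (2 * β - 1) = f x ^ (2 * β - 2) * f x := by
          rw [← Real.rpow_add_one hfx.ne']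
          congr 1
          ring
        have h2 := mul_le_mul_of_nonneg_left (hcv x hsx)
          (mul_nonneg hk0 (Real.rpow_nonneg hfx.le (2 * β - 2)))
        rw [show 2 * β - 1 - 1 = 2 * β - 2 by ring, h1, ← hk]
        linarith)
    have hΨT : 0 ≤ k * (f T ^ (2 * β - 1) * f' T) := by
      have hsT := hbm (hTb ⟨le_rfl, hT1⟩)
      exact mul_nonneg hk0 (mul_nonneg (Real.rpow_nonneg (hpos T hsT).le _) (hf'0 T (hsub' hsT)))
    have h2β : f t * f t ^ (2 * β - 1) = f t ^ (2 * β) := by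
      rw [mul_comm, ← Real.rpow_add_one hx0.ne']
      congr 1
      ring
    have hφ2 : φ t ^ 2 = f t ^ (2 * β) := by
      rw [hφb t (hTb ht).1, ← Real.rpow_mul_natCast hx0.le, mul_comm, Nat.cast_ofNat]
    have hpow : (f' t ^ (1 / (β + 1)) * f t ^ (1 - 2 / (β + 1)) * f t) ^ (β + 1) =
        f' t * f t ^ (2 * β) := by
      have hβ1 : β + 1 ≠ 0 := by linarith
      rw [mul_assoc, ← Real.rpow_add_one hx0.ne', Real.mul_rpow (by positivity) (by positivity),
        ← Real.rpow_mul (by linarith), ← Real.rpow_mul hx0.le, one_div_mul_cancel hβ1,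
        Real.rpow_one]
      congr 2
      field_simp
      ring
    have hsq : f t ^ 2 ≤ f' t * f t ^ (2 * β) := by
      have h1 : f t ^ 2 ≤ f t ^ (2 * β) := by
        rw [← Real.rpow_natCast]
        exact Real.rpow_le_rpow_of_exponent_le hx1 (by push_cast; linarith)
      nlinarith [sq_nonneg (f t)]
    have hmain : κ * (f' t * f t ^ (2 * β)) - g T * f t ≤ f' t * φ t ^ 2 - f t * g t := by
      have h1 : f t * g t ≤ f t * (g T + k * (f t ^ (2 * β - 1) * f' t)) :=
        mul_le_mul_of_nonneg_left (by linarith) hx0.le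
      have h2 : f t * (k * (f t ^ (2 * β - 1) * f' t)) = k * (f' t * f t ^ (2 * β)) := by
        rw [← h2β]
        ring
      rw [hφ2, hκ]
      linarith
    rw [hpow]
    have h3 := mul_le_mul_of_nonneg_left hmain (by positivity : 0 ≤ 2 / κ)
    have h4 : 2 / κ * (κ * (f' t * f t ^ (2 * β)) - g T * f t) =
        2 * (f' t * f t ^ (2 * β)) - 2 * (g T / κ) * f t := by
      field_simp
    rw [h4] at h3
    rw [← div_pow]
    linarith [sq_nonneg (g T / κ - f t)]
  · exact h.exists_lt_primitive_rpow_mul_rpow hmf' htf hF ⟨ha0.trans hab, hb1⟩ (by linarith)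
      (fun t ht => hs1 t ⟨(hbm ht).1.le, ht.2⟩) hQ C

end PowerProfile

/-- Global estimate for the Dirichlet problem: if `u` is a stable solution of
`-Δu = f(u)` in a smooth bounded domain `Ω`, vanishing on `∂Ω`, with `f ≥ 0`, `f' ≥ 0`,
`f'' ≥ 0`, `F(1) = +∞`, and either `n ≤ 2`, or `3 ≤ n ≤ 6` and `f^{-θ}` concave near `1` for
some `θ > 0`, then `‖u‖_{L∞(Ω)} ≤ C < 1` with `C = C(Ω, f)`. -/
theorem stmt2 (n : ℕ) (hn : 1 ≤ n) (Ω : Set (EuclideanSpace ℝ (Fin n)))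
    (hΩ : SmoothBoundedDomain Ω) (f f' f'' : ℝ → ℝ)
    (hC2 : C2On01 f f' f'')
    (hf0 : ∀ t ∈ Ico (0:ℝ) 1, 0 ≤ f t)
    (hf'0 : ∀ t ∈ Ico (0:ℝ) 1, 0 ≤ f' t)
    (hf''0 : ∀ t ∈ Ico (0:ℝ) 1, 0 ≤ f'' t)
    (hF : Tendsto (fun t => ∫ s in (0:ℝ)..t, f s) (𝓝[<] (1:ℝ)) atTop)
    (hcase : n ≤ 2 ∨ (3 ≤ n ∧ n ≤ 6 ∧ ∃ θ : ℝ, 0 < θ ∧ ∃ t₀ ∈ Ico (0:ℝ) 1,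
      ConcaveOn ℝ (Ico t₀ 1) (fun t => f t ^ (-θ)))) :
    ∃ C : ℝ, C < 1 ∧
      ∀ u : EuclideanSpace ℝ (Fin n) → ℝ,
        ContinuousOn u (closure Ω) → ContDiffOn ℝ 2 u Ω →
        (∀ x ∈ Ω, 0 ≤ u x ∧ u x < 1) →
        (∀ x ∈ Ω, -lap u x = f (u x)) →
        (∀ x ∈ frontier Ω, u x = 0) →
        StableSol f' u Ω →
        ∀ x ∈ Ω, u x ≤ C := by
  obtain ⟨hΩo, hΩb, -⟩ := hΩ
  rcases hcase with hn2 | ⟨-, hn6, θ, hθ, t₀, ht₀, hconc⟩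
  · exact exists_uniform_bound_of_le_two hn hn2 hΩo hΩb hC2 hf0 hf'0 hf''0 hF
  · exact exists_uniform_bound_of_le_six hn hn6 hΩo hΩb hC2 hf0 hf'0 hf''0 hF hθ ht₀.2 hconc
end

section
/- Let f ∈ C²([0,1)) be positive with lim_{t→1⁻} f(t) = +∞, and assume f′(t) > 0 for all t sufficiently close to 1. Then: (a) limsup_{t→1⁻} f(t)f″(t)/f′(t)² ≥ 1; (b) if moreover ∫₀¹ f(t) dt = +∞, then liminf_{t→1⁻} f(t)f″(t)/f′(t)² ≤ 2. In particular, if the limit γ = lim_{t→1⁻} f(t)f″(t)/f′(t)² exists, then γ ∈ [1,2]. -/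
open MeasureTheory Set Filter Topology

lemma antitoneOn_Ioo_of_hasDerivAt_nonpos {g g' : ℝ → ℝ} {a b : ℝ}
    (hg : ∀ t ∈ Ioo a b, HasDerivAt g (g' t) t) (hg' : ∀ t ∈ Ioo a b, g' t ≤ 0) :
    AntitoneOn g (Ioo a b) := by
  refine antitoneOn_of_deriv_nonpos (convex_Ioo a b)
    (fun t ht => (hg t ht).continuousAt.continuousWithinAt) ?_ ?_
  · rw [interior_Ioo]
    exact fun t ht => (hg t ht).differentiableAt.differentiableWithinAt
  · rw [interior_Ioo]
    intro t ht
    rw [(hg t ht).deriv]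
    exact hg' t ht

lemma not_tendsto_atTop_of_hasDerivAt_nonpos {g g' : ℝ → ℝ} {a b : ℝ} (hab : a < b)
    (hg : ∀ t ∈ Ioo a b, HasDerivAt g (g' t) t) (hg' : ∀ t ∈ Ioo a b, g' t ≤ 0) :
    ¬ Tendsto g (𝓝[<] b) atTop := by
  intro h
  obtain ⟨m, hm⟩ := exists_between hab
  obtain ⟨t, ht, hmt⟩ :=
    ((h.eventually_gt_atTop (g m)).and (Ioo_mem_nhdsLT hm.2)).exists
  exact absurd (antitoneOn_Ioo_of_hasDerivAt_nonpos hg hg' hm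
    ⟨hm.1.trans hmt.1, hmt.2⟩ hmt.1.le) (not_le.2 ht)

lemma exists_Ioo_of_eventually_nhdsLT_one {p : ℝ → Prop} (h : ∀ᶠ t in 𝓝[<] (1 : ℝ), p t) :
    ∃ a ∈ Ico (0 : ℝ) 1, ∀ t ∈ Ioo a 1, p t :=
  (mem_nhdsLT_iff_exists_mem_Ico_Ioo_subset zero_lt_one).1 h

/-- If `f f'' < f'²` near `1`, then `f` does not blow up at `1`. -/
lemma one_le_limsup_of_blowup {f f' f'' : ℝ → ℝ}
    (hf : ∀ t ∈ Ioo (0 : ℝ) 1, HasDerivAt f (f' t) t)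
    (hf' : ∀ t ∈ Ioo (0 : ℝ) 1, HasDerivAt f' (f'' t) t)
    (hfpos : ∀ t ∈ Ioo (0 : ℝ) 1, 0 < f t)
    (hblow : Tendsto f (𝓝[<] (1 : ℝ)) atTop)
    (hf'pos : ∀ᶠ t in 𝓝[<] (1 : ℝ), 0 < f' t) :
    (1 : EReal) ≤
      limsup (fun t => ((f t * f'' t / f' t ^ 2 : ℝ) : EReal)) (𝓝[<] (1 : ℝ)) := by
  by_contra! hlt
  obtain ⟨a, ha, H⟩ := exists_Ioo_of_eventually_nhdsLT_one
    ((eventually_lt_of_limsup_lt hlt).and hf'pos)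
  have sub : ∀ t ∈ Ioo a 1, t ∈ Ioo (0 : ℝ) 1 := fun t ht => ⟨ha.1.trans_lt ht.1, ht.2⟩
  have hq : AntitoneOn (fun t => f' t / f t) (Ioo a 1) := by
    refine antitoneOn_Ioo_of_hasDerivAt_nonpos
      (fun t ht => (hf' t (sub t ht)).div (hf t (sub t ht)) (hfpos t (sub t ht)).ne') ?_
    intro t ht
    obtain ⟨h1, h2⟩ := H t ht
    have h3 : f t * f'' t / f' t ^ 2 < 1 := by exact_mod_cast h1
    rw [div_lt_one (by positivity)] at h3
    exact div_nonpos_of_nonpos_of_nonneg (by nlinarith) (sq_nonneg _)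
  obtain ⟨m, hm⟩ := exists_between ha.2
  set C := f' m / f m with hC
  refine not_tendsto_atTop_of_hasDerivAt_nonpos (g := fun t => Real.log (f t) - C * t)
    (g' := fun t => f' t / f t - C * 1) hm.2 ?_ ?_ ?_
  · intro t ht
    have ht0 := sub t ⟨hm.1.trans ht.1, ht.2⟩
    exact ((hf t ht0).log (hfpos t ht0).ne').sub ((hasDerivAt_id t).const_mul C)
  · intro t ht
    have := hq hm ⟨hm.1.trans ht.1, ht.2⟩ ht.1.le
    simp only [] at this
    linarith
  · have hlin : Tendsto (fun t : ℝ => -(C * t)) (𝓝[<] (1 : ℝ)) (𝓝 (-(C * 1))) :=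
      ((by fun_prop : Continuous fun t : ℝ => -(C * t)).tendsto 1).mono_left nhdsWithin_le_nhds
    simpa only [sub_eq_add_neg, Function.comp_def] using
      (Real.tendsto_log_atTop.comp hblow).atTop_add hlin

/-- If `f f'' > c f'²` near `1` with `c > 2`, then `f` is integrable on `[0,1)`. -/
lemma liminf_le_two_of_integral_diverges {f f' f'' : ℝ → ℝ}
    (hf : ∀ t ∈ Ioo (0 : ℝ) 1, HasDerivAt f (f' t) t)
    (hf' : ∀ t ∈ Ioo (0 : ℝ) 1, HasDerivAt f' (f'' t) t)
    (hfc : ContinuousOn f (Ico (0 : ℝ) 1))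
    (hfpos : ∀ t ∈ Ioo (0 : ℝ) 1, 0 < f t)
    (hf'pos : ∀ᶠ t in 𝓝[<] (1 : ℝ), 0 < f' t)
    (hint : Tendsto (fun t => ∫ s in (0 : ℝ)..t, f s) (𝓝[<] (1 : ℝ)) atTop) :
    liminf (fun t => ((f t * f'' t / f' t ^ 2 : ℝ) : EReal)) (𝓝[<] (1 : ℝ)) ≤ 2 := by
  by_contra! hlt
  obtain ⟨c, hc2, hc⟩ := EReal.lt_iff_exists_real_btwn.1 hlt
  replace hc2 : (2 : ℝ) < c := EReal.coe_lt_coe_iff.1 hc2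
  obtain ⟨a, ha, H⟩ := exists_Ioo_of_eventually_nhdsLT_one
    ((eventually_lt_of_lt_liminf hc).and hf'pos)
  have sub : ∀ t ∈ Ioo a 1, t ∈ Ioo (0 : ℝ) 1 := fun t ht => ⟨ha.1.trans_lt ht.1, ht.2⟩
  have hq : AntitoneOn (fun t => -(f' t * f t ^ (-c))) (Ioo a 1) := by
    refine antitoneOn_Ioo_of_hasDerivAt_nonpos (fun t ht => ((hf' t (sub t ht)).mul
      ((hf t (sub t ht)).rpow_const (p := -c) (Or.inl (hfpos t (sub t ht)).ne'))).neg) ?_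
    intro t ht
    obtain ⟨h1, h2⟩ := H t ht
    have hp := hfpos t (sub t ht)
    have h3 : c < f t * f'' t / f' t ^ 2 := by exact_mod_cast h1
    rw [lt_div_iff₀ (by positivity)] at h3
    have e : f t ^ (-c) = f t ^ (-c - 1) * f t := by
      rw [← Real.rpow_add_one hp.ne']; ring_nf
    have hr : 0 < f t ^ (-c - 1) := Real.rpow_pos_of_pos hp _
    rw [e]
    nlinarith
  obtain ⟨m, hm⟩ := exists_between ha.2
  set δ := f' m * f m ^ (-c) with hδ
  have hδ0 : 0 < δ := mul_pos (H m hm).2 (Real.rpow_pos_of_pos (hfpos m (sub m hm)) _)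
  have hK : 0 < (δ * (c - 2))⁻¹ := inv_pos.2 (mul_pos hδ0 (by linarith))
  refine not_tendsto_atTop_of_hasDerivAt_nonpos
    (g := fun t => (∫ s in (0 : ℝ)..t, f s) + (δ * (c - 2))⁻¹ * f t ^ (2 - c))
    (g' := fun t => f t + (δ * (c - 2))⁻¹ * (f' t * (2 - c) * f t ^ (2 - c - 1))) hm.2 ?_ ?_ ?_
  · intro t ht
    have ht0 := sub t ⟨hm.1.trans ht.1, ht.2⟩
    refine HasDerivAt.add ?_
      (((hf t ht0).rpow_const (Or.inl (hfpos t ht0).ne')).const_mul _)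
    refine intervalIntegral.integral_hasDerivAt_right ?_ ?_ (hf t ht0).continuousAt
    · refine (hfc.mono ?_).intervalIntegrable
      rw [uIcc_of_le ht0.1.le]
      exact Icc_subset_Ico_right ht0.2
    · exact (hfc.mono Ioo_subset_Ico_self).stronglyMeasurableAtFilter isOpen_Ioo t ht0
  · intro t ht
    have ht1 : t ∈ Ioo a 1 := ⟨hm.1.trans ht.1, ht.2⟩
    have hp := hfpos t (sub t ht1)
    have h : δ ≤ f' t * f t ^ (-c) := neg_le_neg_iff.1 (hq hm ht1 ht.1.le)
    have e : f t ^ (2 - c - 1) = f t ^ (-c) * f t := by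
      rw [← Real.rpow_add_one hp.ne']; ring_nf
    have hne : c - 2 ≠ 0 := by linarith
    have e2 : f t + (δ * (c - 2))⁻¹ * (f' t * (2 - c) * f t ^ (2 - c - 1))
        = (δ - f' t * f t ^ (-c)) * (f t / δ) := by
      rw [e]; field_simp; ring
    rw [e2]
    exact mul_nonpos_of_nonpos_of_nonneg (by linarith) (by positivity)
  · refine tendsto_atTop_mono' _ ?_ hint
    filter_upwards [Ioo_mem_nhdsLT hm.2] with t ht
    have hp := hfpos t (sub t ⟨hm.1.trans ht.1, ht.2⟩)
    have : 0 < f t ^ (2 - c) := Real.rpow_pos_of_pos hp _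
    nlinarith [mul_pos hK this]

/-- (Proposition A.1) Let `f ∈ C²([0,1))` be positive with `f(t) → +∞` as
`t → 1⁻` and `f' > 0` near `1`. Then (a) `limsup_{t→1⁻} f f''/f'² ≥ 1`; (b) if moreover
`∫₀¹ f = +∞`, then `liminf_{t→1⁻} f f''/f'² ≤ 2`; in particular, if the limit `γ` exists,
`γ ∈ [1,2]`. (The limsup/liminf are taken in `EReal`.) -/
theorem stmt13 (f f' f'' : ℝ → ℝ)
    (hC2 : C2On01 f f' f'')
    (hfpos : ∀ t ∈ Ico (0:ℝ) 1, 0 < f t)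
    (hblow : Tendsto f (𝓝[<] (1:ℝ)) atTop)
    (hf'pos : ∀ᶠ t in 𝓝[<] (1:ℝ), 0 < f' t) :
    (1 : EReal) ≤
        Filter.limsup (fun t => ((f t * f'' t / f' t ^ 2 : ℝ) : EReal)) (𝓝[<] (1:ℝ)) ∧
      (Tendsto (fun t => ∫ s in (0:ℝ)..t, f s) (𝓝[<] (1:ℝ)) atTop →
        Filter.liminf (fun t => ((f t * f'' t / f' t ^ 2 : ℝ) : EReal)) (𝓝[<] (1:ℝ)) ≤ 2 ∧
        ∀ γ : ℝ, Tendsto (fun t => f t * f'' t / f' t ^ 2) (𝓝[<] (1:ℝ)) (𝓝 γ) →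
          1 ≤ γ ∧ γ ≤ 2) := by
  obtain ⟨h1, h2, -⟩ := hC2
  have hnhds : ∀ t ∈ Ioo (0 : ℝ) 1, Ico (0 : ℝ) 1 ∈ 𝓝 t := fun t ht => Ico_mem_nhds ht.1 ht.2
  have hf : ∀ t ∈ Ioo (0 : ℝ) 1, HasDerivAt f (f' t) t := fun t ht =>
    (h1 t (Ioo_subset_Ico_self ht)).hasDerivAt (hnhds t ht)
  have hf' : ∀ t ∈ Ioo (0 : ℝ) 1, HasDerivAt f' (f'' t) t := fun t ht =>
    (h2 t (Ioo_subset_Ico_self ht)).hasDerivAt (hnhds t ht)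
  have hpos : ∀ t ∈ Ioo (0 : ℝ) 1, 0 < f t := fun t ht => hfpos t (Ioo_subset_Ico_self ht)
  have hsup := one_le_limsup_of_blowup hf hf' hpos hblow hf'pos
  refine ⟨hsup, fun hint => ?_⟩
  have hinf := liminf_le_two_of_integral_diverges hf hf'
    (fun t ht => (h1 t ht).continuousWithinAt) hpos hf'pos hint
  refine ⟨hinf, fun γ hγ => ?_⟩
  have hγ' := (continuous_coe_real_ereal.tendsto γ).comp hγ
  simp only [Function.comp_def] at hγ'
  rw [hγ'.limsup_eq] at hsup
  rw [hγ'.liminf_eq] at hinf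
  exact ⟨EReal.coe_le_coe_iff.1 hsup, EReal.coe_le_coe_iff.1 hinf⟩
end
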